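/- arXiv:1606.08229 — 16 statements merged into one kernel-verified Lean document; each statement's English description precedes it below -/
import Mathlib

section
/- Let V and W be Archimedean ordered real vector spaces with order units v and w respectively. If ξ : V → W is an additive map (ξ(a+b) = ξ(a)+ξ(b) for all a,b ∈ V) that is positive (0 ≤ a implies 0 ≤ ξ(a)), then ξ is ℝ-linear, i.e., ξ(α•a) = α•ξ(a) for all α ∈ ℝ and a ∈ V. -/
/-- A positive additive map between Archimedean ordered real vector
spaces with order units is automatically ℝ-linear. -/
theorem stmt_0
    {V W : Type*}
    [AddCommGroup V] [PartialOrder V] [Module ℝ V]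
    [AddCommGroup W] [PartialOrder W] [Module ℝ W]
    (haddV : ∀ a b c : V, a ≤ b → a + c ≤ b + c)
    (hsmulV : ∀ (α : ℝ) (a : V), 0 ≤ α → 0 ≤ a → 0 ≤ α • a)
    (haddW : ∀ a b c : W, a ≤ b → a + c ≤ b + c)
    (hsmulW : ∀ (α : ℝ) (a : W), 0 ≤ α → 0 ≤ a → 0 ≤ α • a)
    (v : V) (w : W) (hv : 0 ≤ v) (hw : 0 ≤ w)
    (hunitV : ∀ a : V, ∃ n : ℕ, a ≤ n • v)
    (hunitW : ∀ a : W, ∃ n : ℕ, a ≤ n • w)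
    (harchV : ∀ a : V, (∃ b : V, ∀ n : ℕ, n • a ≤ b) → a ≤ 0)
    (harchW : ∀ a : W, (∃ b : W, ∀ n : ℕ, n • a ≤ b) → a ≤ 0)
    (ξ : V → W)
    (hadd : ∀ a b : V, ξ (a + b) = ξ a + ξ b)
    (hpos : ∀ a : V, 0 ≤ a → 0 ≤ ξ a) :
    ∀ (α : ℝ) (a : V), ξ (α • a) = α • ξ a := by
  haveI : IsOrderedAddMonoid V := ⟨fun a b h c => haddV a b c h, fun a b h c => by
    simpa only [add_comm c] using haddV a b c h⟩
  haveI : IsOrderedAddMonoid W := ⟨fun a b h c => haddW a b c h, fun a b h c => by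
    simpa only [add_comm c] using haddW a b c h⟩
  obtain ⟨f, hf⟩ : ∃ f : V →+ W, ∀ a, f a = ξ a := ⟨AddMonoidHom.mk' ξ hadd, fun a => rfl⟩
  simp only [← hf] at hpos ⊢
  have key : ∀ (α : ℝ) (a : V), 0 ≤ a → f (α • a) = α • f a := by
    intro α a ha
    have hn : ∀ n : ℕ, n • (f (α • a) - α • f a)
        = f (Int.fract (n * α) • a) - Int.fract (n * α) • f a := by
      intro n
      have h1 : f ((⌊(n : ℝ) * α⌋ : ℝ) • a) = (⌊(n : ℝ) * α⌋ : ℝ) • f a := by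
        rw [Int.cast_smul_eq_zsmul, Int.cast_smul_eq_zsmul, map_zsmul]
      have h2 : n • (α • a) = ((n : ℝ) * α) • a := by
        rw [mul_smul, Nat.cast_smul_eq_nsmul]
      have h3 : n • (α • f a) = ((n : ℝ) * α) • f a := by
        rw [mul_smul, Nat.cast_smul_eq_nsmul]
      rw [smul_sub, ← map_nsmul, h2, h3, Int.fract, sub_smul, sub_smul, map_sub, h1]
      abel
    have hfa := hpos a ha
    have A : ∀ n : ℕ, f (Int.fract ((n : ℝ) * α) • a) ≤ f a := by
      intro n
      have := hpos _ (hsmulV (1 - Int.fract ((n : ℝ) * α)) a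
        (sub_nonneg.2 (Int.fract_lt_one _).le) ha)
      rw [sub_smul, one_smul, map_sub] at this
      exact sub_nonneg.1 this
    have B : ∀ n : ℕ, Int.fract ((n : ℝ) * α) • f a ≤ f a := by
      intro n
      have := hsmulW (1 - Int.fract ((n : ℝ) * α)) (f a)
        (sub_nonneg.2 (Int.fract_lt_one _).le) hfa
      rw [sub_smul, one_smul] at this
      exact sub_nonneg.1 this
    apply le_antisymm
    · apply sub_nonpos.1
      refine harchW _ ⟨f a, fun n => ?_⟩
      rw [hn]
      exact (sub_le_self _ (hsmulW _ _ (Int.fract_nonneg _) hfa)).trans (A n)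
    · apply sub_nonpos.1
      refine harchW _ ⟨f a, fun n => ?_⟩
      rw [← neg_sub, smul_neg, hn, neg_sub]
      exact (sub_le_self _ (hpos _ (hsmulV _ _ (Int.fract_nonneg _) ha))).trans (B n)
  intro α a
  obtain ⟨n, hn⟩ := hunitV a
  have h1 := key α (n • v) (nsmul_nonneg hv n)
  have h2 := key α (n • v - a) (sub_nonneg.2 hn)
  rw [smul_sub, map_sub, map_sub, smul_sub, h1] at h2
  exact sub_right_injective h2
end

section
/- Let V and W be Archimedean ordered real vector spaces with order units v and w respectively, and let E(V,v) = {a ∈ V : 0 ≤ a ≤ v} and E(W,w) = {b ∈ W : 0 ≤ b ≤ w}. Suppose ω : E(V,v) → E(W,w) satisfies ω(v) = w and ω(a+b) = ω(a) + ω(b) whenever a, b, a+b ∈ E(V,v). Then there exists a unique positive ℝ-linear map ξ : V → W that agrees with ω on E(V,v); moreover ξ(v) = w. -/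
section helpers
variable {V W : Type*}
  [AddCommGroup V] [PartialOrder V] [IsOrderedAddMonoid V] [Module ℝ V] [PosSMulMono ℝ V]
  [AddCommGroup W] [PartialOrder W] [IsOrderedAddMonoid W] [Module ℝ W] [PosSMulMono ℝ W]

/-- Real homogeneity of a positive additive map into an Archimedean space, on the cone. -/
theorem aux_homog (harchW : ∀ a : W, (∃ b : W, ∀ n : ℕ, n • a ≤ b) → a ≤ 0)
    (ξ : V →+ W) (hpos : ∀ a, 0 ≤ a → 0 ≤ ξ a) (a : V) (ha : 0 ≤ a) (α : ℝ) :
    ξ (α • a) = α • ξ a := by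
  have hint : ∀ (n : ℕ), ∃ t : ℝ, 0 ≤ t ∧ t ≤ 1 ∧
      n • (ξ (α • a) - α • ξ a) = ξ (t • a) - t • ξ a := by
    intro n
    refine ⟨Int.fract (n * α), Int.fract_nonneg _, (Int.fract_lt_one _).le, ?_⟩
    have e1 : ∀ {X : Type _} [AddCommGroup X] [Module ℝ X] (x : X),
        Int.fract (n * α) • x = n • (α • x) - ⌊n * α⌋ • x := by
      intro X _ _ x
      rw [Int.fract, sub_smul, mul_smul, Nat.cast_smul_eq_nsmul, Int.cast_smul_eq_zsmul]
    have e2 : Int.fract (n * α) • ξ a = n • (α • ξ a) - ⌊n * α⌋ • ξ a := by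
      rw [Int.fract, sub_smul, mul_smul, Nat.cast_smul_eq_nsmul, Int.cast_smul_eq_zsmul]
    rw [e1 a, e2, map_sub, map_nsmul, map_zsmul, nsmul_sub]
    abel
  have hle : ∀ (x : V), 0 ≤ x → ∀ t : ℝ, t ≤ 1 → t • x ≤ x := by
    intro x hx t ht
    have := smul_nonneg (sub_nonneg.2 ht) hx
    rw [sub_smul, one_smul] at this
    exact sub_nonneg.1 this
  have hleW : ∀ (x : W), 0 ≤ x → ∀ t : ℝ, t ≤ 1 → t • x ≤ x := by
    intro x hx t ht
    have := smul_nonneg (sub_nonneg.2 ht) hx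
    rw [sub_smul, one_smul] at this
    exact sub_nonneg.1 this
  have hξa := hpos a ha
  have hmono : ∀ x y : V, x ≤ y → ξ x ≤ ξ y := by
    intro x y h
    have := hpos _ (sub_nonneg.2 h)
    rw [map_sub] at this
    exact sub_nonneg.1 this
  apply le_antisymm
  · apply sub_nonpos.1
    apply harchW
    refine ⟨ξ a, fun n => ?_⟩
    obtain ⟨t, h0, h1, e⟩ := hint n
    rw [e]
    exact (sub_le_self _ (smul_nonneg h0 hξa)).trans (hmono _ _ (hle a ha t h1))
  · apply sub_nonpos.1
    apply harchW
    refine ⟨ξ a, fun n => ?_⟩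
    obtain ⟨t, h0, h1, e⟩ := hint n
    rw [← neg_sub, smul_neg, e, neg_sub]
    exact (sub_le_self _ (hpos _ (smul_nonneg h0 ha))).trans (hleW _ hξa t h1)

/-- Extension of an additive map on the interval to an additive map on the cone. -/
theorem aux_cone (v : V) (hunitV : ∀ a : V, ∃ n : ℕ, a ≤ n • v) (hv : 0 ≤ v)
    (f : V → W) (hf0 : ∀ a, 0 ≤ a → a ≤ v → 0 ≤ f a)
    (hf : ∀ a b, 0 ≤ a → 0 ≤ b → a + b ≤ v → f (a + b) = f a + f b) :
    ∃ g : V → W, (∀ a, 0 ≤ a → 0 ≤ g a) ∧ (∀ a, 0 ≤ a → a ≤ v → g a = f a) ∧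
      ∀ a b, 0 ≤ a → 0 ≤ b → g (a + b) = g a + g b := by
  have hfz : f 0 = 0 := by
    have := hf 0 0 le_rfl le_rfl (by simpa using hv)
    simpa using this
  have hn : ∀ (n : ℕ) (a : V), 0 ≤ a → n • a ≤ v → f (n • a) = n • f a := by
    intro n a ha
    induction n with
    | zero => intro _; simpa using hfz
    | succ k ih =>
      intro h
      rw [succ_nsmul] at h
      have h' : k • a ≤ v := (le_add_of_nonneg_right ha).trans h
      rw [succ_nsmul, hf _ _ (nsmul_nonneg ha k) ha h, ih h', succ_nsmul]
  have hdiv : ∀ (n : ℕ) (a : V), a ≤ (n + 1) • v → ((n + 1 : ℕ) : ℝ)⁻¹ • a ≤ v := by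
    intro n a h
    have h2 : (0 : ℝ) < ((n + 1 : ℕ) : ℝ) := by positivity
    have := smul_le_smul_of_nonneg_left h (inv_nonneg.2 h2.le)
    rwa [← Nat.cast_smul_eq_nsmul ℝ, smul_smul, inv_mul_cancel₀ h2.ne', one_smul] at this
  have hex : ∀ a : V, ∃ n : ℕ, a ≤ (n + 1) • v := by
    intro a
    obtain ⟨n, h⟩ := hunitV a
    exact ⟨n, h.trans (by rw [succ_nsmul]; exact le_add_of_nonneg_right hv)⟩
  have key : ∀ (a : V), 0 ≤ a → ∀ n m : ℕ, a ≤ (n + 1) • v →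
      (n + 1) • f (((n + 1 : ℕ) : ℝ)⁻¹ • a) =
      ((m + 1) * (n + 1)) • f ((((m + 1) * (n + 1) : ℕ) : ℝ)⁻¹ • a) := by
    intro a ha n m h
    have h1 : (0 : ℝ) < ((n + 1 : ℕ) : ℝ) := by positivity
    have h2 : (0 : ℝ) < ((m + 1 : ℕ) : ℝ) := by positivity
    have e : ((n + 1 : ℕ) : ℝ)⁻¹ • a = (m + 1) • ((((m + 1) * (n + 1) : ℕ) : ℝ)⁻¹ • a) := by
      rw [← Nat.cast_smul_eq_nsmul ℝ, smul_smul]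
      congr 1
      rw [Nat.cast_mul]
      field_simp
    have h3 := hdiv n a h
    rw [e] at h3
    rw [e, hn (m + 1) _ (smul_nonneg (by positivity) ha) h3, smul_smul, mul_comm]
  choose N hN using hex
  have hg : ∀ (a : V), 0 ≤ a → ∀ n : ℕ, a ≤ (n + 1) • v →
      (N a + 1) • f (((N a + 1 : ℕ) : ℝ)⁻¹ • a) = (n + 1) • f (((n + 1 : ℕ) : ℝ)⁻¹ • a) := by
    intro a ha n h
    rw [key a ha n (N a) h, key a ha (N a) n (hN a), mul_comm]
  refine ⟨fun a => (N a + 1) • f (((N a + 1 : ℕ) : ℝ)⁻¹ • a), ?_, ?_, ?_⟩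
  · intro a ha
    exact nsmul_nonneg (hf0 _ (smul_nonneg (by positivity) ha) (hdiv _ _ (hN a))) _
  · intro a ha hav
    have := hg a ha 0 (by simpa using hav)
    simpa using this
  · intro a b ha hb
    have hab := hN (a + b)
    have h1 : a ≤ (N (a + b) + 1) • v := (le_add_of_nonneg_right hb).trans hab
    have h2 : b ≤ (N (a + b) + 1) • v := (le_add_of_nonneg_left ha).trans hab
    have h3 := hdiv _ _ hab
    rw [smul_add] at h3
    simp only []
    rw [hg a ha _ h1, hg b hb _ h2, smul_add,
      hf _ _ (smul_nonneg (by positivity) ha) (smul_nonneg (by positivity) hb) h3, nsmul_add]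

/-- Extension of an additive map on the cone to an additive map on the space. -/
theorem aux_ext (v : V) (hunitV : ∀ a : V, ∃ n : ℕ, a ≤ n • v) (hv : 0 ≤ v)
    (g : V → W) (hg : ∀ a b, 0 ≤ a → 0 ≤ b → g (a + b) = g a + g b) :
    ∃ ξ : V →+ W, ∀ a, 0 ≤ a → ξ a = g a := by
  have hex : ∀ a : V, ∃ p : V, 0 ≤ p ∧ 0 ≤ a + p := by
    intro a
    obtain ⟨n, h⟩ := hunitV (-a)
    exact ⟨n • v, nsmul_nonneg hv n, by simpa using add_le_add_right h a⟩
  choose p hp hap using hex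
  refine ⟨AddMonoidHom.mk' (fun a => g (a + p a) - g (p a)) ?_, ?_⟩
  · intro a b
    have e1 := hg (a + b + p (a + b)) (p a + p b) (hap _) (add_nonneg (hp a) (hp b))
    have e2 := hg (a + p a + (b + p b)) (p (a + b)) (add_nonneg (hap a) (hap b)) (hp _)
    rw [hg _ _ (hp a) (hp b)] at e1
    rw [hg _ _ (hap a) (hap b)] at e2
    have e3 : a + b + p (a + b) + (p a + p b) = a + p a + (b + p b) + p (a + b) := by abel
    rw [e3, e2] at e1
    rw [sub_add_sub_comm, sub_eq_sub_iff_add_eq_add]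
    exact e1.symm
  · intro a ha
    simp [hg a (p a) ha (hp a)]

end helpers

/-- An effect-algebra morphism between the unit intervals of two
Archimedean order-unit spaces extends uniquely to a positive normalized linear map. -/
theorem stmt_1
    {V W : Type*}
    [AddCommGroup V] [PartialOrder V] [Module ℝ V]
    [AddCommGroup W] [PartialOrder W] [Module ℝ W]
    (haddV : ∀ a b c : V, a ≤ b → a + c ≤ b + c)
    (hsmulV : ∀ (α : ℝ) (a : V), 0 ≤ α → 0 ≤ a → 0 ≤ α • a)
    (haddW : ∀ a b c : W, a ≤ b → a + c ≤ b + c)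
    (hsmulW : ∀ (α : ℝ) (a : W), 0 ≤ α → 0 ≤ a → 0 ≤ α • a)
    (v : V) (w : W) (hv : 0 ≤ v) (hw : 0 ≤ w)
    (hunitV : ∀ a : V, ∃ n : ℕ, a ≤ n • v)
    (hunitW : ∀ a : W, ∃ n : ℕ, a ≤ n • w)
    (harchV : ∀ a : V, (∃ b : V, ∀ n : ℕ, n • a ≤ b) → a ≤ 0)
    (harchW : ∀ a : W, (∃ b : W, ∀ n : ℕ, n • a ≤ b) → a ≤ 0)
    (ω : {a : V // 0 ≤ a ∧ a ≤ v} → W)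
    (hrange : ∀ e, 0 ≤ ω e ∧ ω e ≤ w)
    (hωv : ω ⟨v, hv, le_refl v⟩ = w)
    (hωadd : ∀ (a b : {a : V // 0 ≤ a ∧ a ≤ v})
      (hab : 0 ≤ (a : V) + (b : V) ∧ (a : V) + (b : V) ≤ v),
      ω ⟨(a : V) + (b : V), hab⟩ = ω a + ω b) :
    (∃! ξ : V →ₗ[ℝ] W,
        (∀ a : V, 0 ≤ a → 0 ≤ ξ a) ∧
        ∀ e : {a : V // 0 ≤ a ∧ a ≤ v}, ξ (e : V) = ω e) ∧
      ∀ ξ : V →ₗ[ℝ] W,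
        ((∀ a : V, 0 ≤ a → 0 ≤ ξ a) ∧
          ∀ e : {a : V // 0 ≤ a ∧ a ≤ v}, ξ (e : V) = ω e) → ξ v = w := by
  haveI : IsOrderedAddMonoid V :=
    { add_le_add_left := fun a b h c => by simpa [add_comm] using haddV a b c h }
  haveI : IsOrderedAddMonoid W :=
    { add_le_add_left := fun a b h c => by simpa [add_comm] using haddW a b c h }
  haveI : PosSMulMono ℝ V := PosSMulMono.of_smul_nonneg fun α h a ha => hsmulV α a h ha
  haveI : PosSMulMono ℝ W := PosSMulMono.of_smul_nonneg fun α h a ha => hsmulW α a h ha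
  classical
  obtain ⟨g, g0, gf, gadd⟩ := aux_cone v hunitV hv
    (fun a => if h : 0 ≤ a ∧ a ≤ v then ω ⟨a, h⟩ else 0)
    (by
      intro a h1 h2
      simp only [dif_pos (And.intro h1 h2)]
      exact (hrange _).1)
    (by
      intro a b ha hb hab
      have h1 : 0 ≤ a ∧ a ≤ v := ⟨ha, (le_add_of_nonneg_right hb).trans hab⟩
      have h2 : 0 ≤ b ∧ b ≤ v := ⟨hb, (le_add_of_nonneg_left ha).trans hab⟩
      have h3 : 0 ≤ a + b ∧ a + b ≤ v := ⟨add_nonneg ha hb, hab⟩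
      simp only [dif_pos h1, dif_pos h2, dif_pos h3]
      exact hωadd ⟨a, h1⟩ ⟨b, h2⟩ h3)
  obtain ⟨ξ, hξ⟩ := aux_ext v hunitV hv g gadd
  have hpos : ∀ a, 0 ≤ a → 0 ≤ ξ a := fun a ha => by rw [hξ a ha]; exact g0 a ha
  have hex : ∀ a : V, ∃ p : V, 0 ≤ p ∧ 0 ≤ a + p := by
    intro a
    obtain ⟨n, h⟩ := hunitV (-a)
    exact ⟨n • v, nsmul_nonneg hv n, by simpa using add_le_add_right h a⟩
  have hlin : ∀ (α : ℝ) (a : V), ξ (α • a) = α • ξ a := by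
    intro α a
    obtain ⟨p, hp, hap⟩ := hex a
    have e1 := aux_homog harchW ξ hpos _ hap α
    rw [smul_add, map_add, map_add, smul_add, aux_homog harchW ξ hpos p hp α] at e1
    exact add_right_cancel e1
  refine ⟨⟨{ toFun := ξ, map_add' := map_add ξ, map_smul' := hlin }, ⟨hpos, ?_⟩, ?_⟩, ?_⟩
  · intro e
    change ξ e = _
    rw [hξ _ e.2.1, gf _ e.2.1 e.2.2, dif_pos e.2]
  · rintro η ⟨_, hη⟩
    have hc : ∀ a, 0 ≤ a → η a = ξ a := by
      intro a ha
      obtain ⟨n, h⟩ := hunitV a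
      have h' : a ≤ (n + 1) • v :=
        h.trans (by rw [succ_nsmul]; exact le_add_of_nonneg_right hv)
      have h2 : (0 : ℝ) < ((n + 1 : ℕ) : ℝ) := by positivity
      have h3 := smul_le_smul_of_nonneg_left h' (inv_nonneg.2 h2.le)
      rw [← Nat.cast_smul_eq_nsmul ℝ, smul_smul, inv_mul_cancel₀ h2.ne', one_smul] at h3
      have h4 : 0 ≤ ((n + 1 : ℕ) : ℝ)⁻¹ • a := smul_nonneg (inv_nonneg.2 h2.le) ha
      have e1 := hη ⟨_, h4, h3⟩
      have e2 : ξ (((n + 1 : ℕ) : ℝ)⁻¹ • a) = ω ⟨_, h4, h3⟩ := by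
        rw [hξ _ h4, gf _ h4 h3, dif_pos ⟨h4, h3⟩]
      rw [← e2] at e1
      simp only [map_smul, hlin] at e1
      have e3 := congrArg (fun x => ((n + 1 : ℕ) : ℝ) • x) e1
      simpa only [smul_smul, mul_inv_cancel₀ h2.ne', one_smul] using e3
    ext a
    change η a = ξ a
    obtain ⟨p, hp, hap⟩ := hex a
    have := hc _ hap
    rw [map_add, map_add, hc p hp] at this
    exact add_right_cancel this
  · rintro η ⟨_, hη⟩
    rw [← hωv]
    exact hη ⟨v, hv, le_refl v⟩
end

section
/- Let V be an Archimedean ordered real vector space with order unit v, and let E(V,v) = {a ∈ V : 0 ≤ a ≤ v}. Then the restriction map ρ ↦ ρ|_{E(V,v)} is a bijection from the set of states on (V,v) onto the set of states on E(V,v) (i.e., maps ω : E(V,v) → [0,1] ⊆ ℝ with ω(v) = 1 and ω(a+b) = ω(a)+ω(b) whenever a, b, a+b ∈ E(V,v)), and this bijection preserves convex combinations: the restriction of λρ₁ + (1-λ)ρ₂ is λω₁ + (1-λ)ω₂ for 0 ≤ λ ≤ 1. -/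
section Helpers

theorem aux_bdd (D : ℝ →+ ℝ) (C : ℝ) (h1 : D 1 = 0)
    (hC : ∀ t, 0 ≤ t → t ≤ 1 → |D t| ≤ C) (t : ℝ) : D t = 0 := by
  have hb : ∀ t, |D t| ≤ C := by
    intro t
    have h : D t = D (Int.fract t) := by
      have h2 : D (⌊t⌋ : ℝ) = 0 := by
        have := map_zsmul D ⌊t⌋ 1
        simpa [h1] using this
      have h3 := map_add D (⌊t⌋ : ℝ) (Int.fract t)
      rw [Int.floor_add_fract, h2, zero_add] at h3
      exact h3
    rw [h]
    exact hC _ (Int.fract_nonneg t) (Int.fract_lt_one t).le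
  by_contra hne
  have hpos : 0 < |D t| := abs_pos.mpr hne
  obtain ⟨n, hn⟩ := exists_nat_gt (C / |D t|)
  rw [div_lt_iff₀ hpos] at hn
  have h := hb ((n : ℝ) * t)
  have h2 : D ((n : ℝ) * t) = n * D t := by
    have := map_nsmul D n t
    simpa using this
  rw [h2, abs_mul, Nat.abs_cast] at h
  linarith

variable {W : Type*} [AddCommGroup W] [PartialOrder W] [Module ℝ W]
  [IsOrderedAddMonoid W] [IsOrderedModule ℝ W]

theorem aux_nsmul (v : W) (f : W → ℝ)
    (fadd : ∀ a b, 0 ≤ a → 0 ≤ b → a + b ≤ v → f (a + b) = f a + f b) (hv : 0 ≤ v)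
    (a : W) (ha : 0 ≤ a) (m : ℕ) (hm : m • a ≤ v) : f (m • a) = m * f a := by
  induction m with
  | zero =>
    have := fadd 0 0 le_rfl le_rfl (by simpa using hv)
    simp at this
    simp [this]
  | succ k ih =>
    rw [succ_nsmul] at hm ⊢
    have hk : 0 ≤ k • a := nsmul_nonneg ha k
    rw [fadd _ _ hk ha hm, ih ((le_add_of_nonneg_right ha).trans hm)]
    push_cast; ring

theorem aux_le (v a : W) (n : ℕ) (hn : 0 < n) (h : a ≤ n • v) : ((n : ℝ)⁻¹) • a ≤ v := by
  have hn' : (n : ℝ) ≠ 0 := by positivity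
  have h2 : ((n : ℝ)⁻¹) • a ≤ ((n : ℝ)⁻¹) • (n • v) :=
    smul_le_smul_of_nonneg_left h (by positivity)
  rwa [← Nat.cast_smul_eq_nsmul ℝ, smul_smul, inv_mul_cancel₀ hn', one_smul] at h2

theorem aux_cone_s2 (v : W) (f : W → ℝ)
    (fadd : ∀ a b, 0 ≤ a → 0 ≤ b → a + b ≤ v → f (a + b) = f a + f b) (hv : 0 ≤ v)
    (hunit : ∀ a : W, ∃ n : ℕ, a ≤ n • v) :
    ∃ G : W → ℝ, ∀ a, 0 ≤ a → ∀ n : ℕ, 0 < n → a ≤ n • v → G a = n * f (((n : ℝ)⁻¹) • a) := by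
  have hu : ∀ a : W, ∃ n : ℕ, 0 < n ∧ a ≤ n • v := by
    intro a
    obtain ⟨n, hn⟩ := hunit a
    refine ⟨n + 1, n.succ_pos, hn.trans ?_⟩
    rw [succ_nsmul]
    exact le_add_of_nonneg_right hv
  choose N hN hNv using hu
  have key : ∀ a : W, 0 ≤ a → ∀ n m : ℕ, 0 < n → 0 < m → a ≤ n • v →
      (n : ℝ) * f (((n : ℝ)⁻¹) • a) = n * m * f (((n : ℝ)⁻¹ * (m : ℝ)⁻¹) • a) := by
    intro a ha n m hn hm h
    have hn' : (n : ℝ) ≠ 0 := by positivity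
    have hm' : (m : ℝ) ≠ 0 := by positivity
    have e : m • (((n : ℝ)⁻¹ * (m : ℝ)⁻¹) • a) = ((n : ℝ)⁻¹) • a := by
      rw [← Nat.cast_smul_eq_nsmul ℝ, smul_smul]
      congr 1
      field_simp
    have := aux_nsmul v f fadd hv (((n : ℝ)⁻¹ * (m : ℝ)⁻¹) • a)
      (smul_nonneg (by positivity) ha) m (by rw [e]; exact aux_le v a n hn h)
    rw [e] at this
    rw [this]; ring
  refine ⟨fun a => N a * f (((N a : ℝ)⁻¹) • a), ?_⟩
  intro a ha n hn h
  show (N a : ℝ) * f (((N a : ℝ)⁻¹) • a) = _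
  rw [key a ha n (N a) hn (hN a) h, key a ha (N a) n (hN a) hn (hNv a),
    mul_comm (n : ℝ) (N a), mul_comm (n : ℝ)⁻¹]

theorem aux_ext_s2 (v : W) (f : W → ℝ)
    (fadd : ∀ a b, 0 ≤ a → 0 ≤ b → a + b ≤ v → f (a + b) = f a + f b) (hv : 0 ≤ v)
    (f0 : ∀ a, 0 ≤ a → a ≤ v → 0 ≤ f a) (f1 : f v = 1)
    (hunit : ∀ a : W, ∃ n : ℕ, a ≤ n • v) :
    ∃ ρ : W →ₗ[ℝ] ℝ, (∀ a, 0 ≤ a → 0 ≤ ρ a) ∧ ∀ a, 0 ≤ a → a ≤ v → ρ a = f a := by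
  obtain ⟨G, hG⟩ := aux_cone_s2 v f fadd hv hunit
  have hu : ∀ a : W, ∃ n : ℕ, 0 < n ∧ a ≤ n • v := by
    intro a
    obtain ⟨n, hn⟩ := hunit a
    refine ⟨n + 1, n.succ_pos, hn.trans ?_⟩
    rw [succ_nsmul]
    exact le_add_of_nonneg_right hv
  have Gadd : ∀ a b, 0 ≤ a → 0 ≤ b → G (a + b) = G a + G b := by
    intro a b ha hb
    obtain ⟨n, hn, h⟩ := hu (a + b)
    have hi : (0 : ℝ) ≤ (n : ℝ)⁻¹ := by positivity
    rw [hG _ (add_nonneg ha hb) n hn h,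
      hG a ha n hn ((le_add_of_nonneg_right hb).trans h),
      hG b hb n hn ((le_add_of_nonneg_left ha).trans h), smul_add,
      fadd _ _ (smul_nonneg hi ha) (smul_nonneg hi hb)
        (by rw [← smul_add]; exact aux_le v _ n hn h)]
    ring
  have G0 : ∀ a, 0 ≤ a → 0 ≤ G a := by
    intro a ha
    obtain ⟨n, hn, h⟩ := hu a
    rw [hG a ha n hn h]
    exact mul_nonneg (by positivity) (f0 _ (smul_nonneg (by positivity) ha) (aux_le v a n hn h))
  have Gf : ∀ a, 0 ≤ a → a ≤ v → G a = f a := by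
    intro a ha h
    rw [hG a ha 1 one_pos (by simpa using h)]
    simp
  have Gv : ∀ n : ℕ, G (n • v) = n := by
    intro n
    induction n with
    | zero =>
      have := Gadd 0 0 le_rfl le_rfl
      simp at this
      simp [this]
    | succ k ih =>
      rw [succ_nsmul, Gadd _ _ (nsmul_nonneg hv k) hv, ih, Gf v hv le_rfl, f1]
      push_cast; ring
  have hneg : ∀ x : W, ∃ n : ℕ, 0 ≤ x + n • v := by
    intro x
    obtain ⟨n, hn⟩ := hunit (-x)
    exact ⟨n, neg_le_iff_add_nonneg'.mp hn⟩
  choose N hN using hneg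
  let F : W → ℝ := fun x => G (x + N x • v) - N x
  have hF : ∀ x, ∀ n : ℕ, 0 ≤ x + n • v → F x = G (x + n • v) - n := by
    intro x n h
    have h1 := Gadd _ _ h (nsmul_nonneg hv (N x))
    have h2 := Gadd _ _ (hN x) (nsmul_nonneg hv n)
    have e : x + n • v + N x • v = x + N x • v + n • v := by abel
    rw [e, h2, Gv, Gv] at h1
    show G (x + N x • v) - N x = _
    linarith
  have Fadd : ∀ x y, F (x + y) = F x + F y := by
    intro x y
    have e : x + y + (N x + N y) • v = (x + N x • v) + (y + N y • v) := by
      rw [add_nsmul]; abel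
    rw [hF (x + y) (N x + N y) (by rw [e]; exact add_nonneg (hN x) (hN y)), e,
      Gadd _ _ (hN x) (hN y)]
    show _ = (G (x + N x • v) - N x) + (G (y + N y • v) - N y)
    push_cast; ring
  let FA : W →+ ℝ := AddMonoidHom.mk' F Fadd
  have FG : ∀ a, 0 ≤ a → FA a = G a := by
    intro a ha
    show F a = G a
    rw [hF a 0 (by simpa using ha)]
    simp
  have Fmono : ∀ a b, a ≤ b → FA a ≤ FA b := by
    intro a b h
    have h1 : 0 ≤ FA (b - a) := by
      rw [FG _ (sub_nonneg.mpr h)]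
      exact G0 _ (sub_nonneg.mpr h)
    rw [map_sub] at h1
    linarith
  have Fv : ∀ n : ℕ, FA (n • v) = n := fun n => by
    rw [FG _ (nsmul_nonneg hv n), Gv]
  have bound : ∀ (x : W) (n : ℕ), x ≤ n • v → ∀ t : ℝ, 0 ≤ t → t ≤ 1 → FA (t • x) ≤ n := by
    intro x n h t h0 h1
    rw [← Fv n]
    apply Fmono
    refine (smul_le_smul_of_nonneg_left h h0).trans ?_
    have := smul_le_smul_of_nonneg_right h1 (nsmul_nonneg hv n)
    rwa [one_smul] at this
  have Fsmul : ∀ (t : ℝ) (x : W), FA (t • x) = t * FA x := by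
    intro t x
    obtain ⟨n, hn⟩ := hunit x
    obtain ⟨m, hm⟩ := hunit (-x)
    let D : ℝ →+ ℝ := AddMonoidHom.mk' (fun t => FA (t • x) - t * FA x) (by
      intro a b
      simp only [add_smul, map_add]
      ring)
    have := aux_bdd D (n + m + |FA x|) (by show FA ((1 : ℝ) • x) - 1 * FA x = 0; simp) (by
      intro t h0 h1
      show |FA (t • x) - t * FA x| ≤ _
      have b1 := bound x n hn t h0 h1
      have b2 := bound (-x) m hm t h0 h1
      rw [smul_neg, map_neg] at b2
      have b3 : |t * FA x| ≤ |FA x| := by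
        rw [abs_mul, abs_of_nonneg h0]
        exact mul_le_of_le_one_left (abs_nonneg _) h1
      have b4 := abs_le.mp b3
      have n0 : (0 : ℝ) ≤ n := by positivity
      have m0 : (0 : ℝ) ≤ m := by positivity
      rw [abs_le]
      constructor <;> linarith) t
    have h : FA (t • x) - t * FA x = 0 := this
    linarith
  refine ⟨{ toFun := FA, map_add' := map_add FA, map_smul' := by intro t x; simpa using Fsmul t x },
    ?_, ?_⟩
  · intro a ha
    show 0 ≤ FA a
    rw [FG a ha]; exact G0 a ha
  · intro a ha h
    show FA a = f a
    rw [FG a ha, Gf a ha h]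

theorem aux_inj (v : W) (hv : 0 ≤ v) (hunit : ∀ a : W, ∃ n : ℕ, a ≤ n • v)
    (ρ σ : W →ₗ[ℝ] ℝ) (h : ∀ a, 0 ≤ a → a ≤ v → ρ a = σ a) : ρ = σ := by
  have pos : ∀ a, 0 ≤ a → ρ a = σ a := by
    intro a ha
    obtain ⟨n, hn⟩ := hunit a
    have hn1 : a ≤ (n + 1) • v := by
      rw [succ_nsmul]
      exact hn.trans (le_add_of_nonneg_right hv)
    have := h _ (smul_nonneg (by positivity) ha) (aux_le v a (n + 1) n.succ_pos hn1)
    rw [map_smul, map_smul] at this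
    have hne : (((n + 1 : ℕ) : ℝ)⁻¹) ≠ 0 := by positivity
    exact mul_left_cancel₀ hne this
  ext x
  obtain ⟨n, hn⟩ := hunit (-x)
  have h1 := pos _ (neg_le_iff_add_nonneg'.mp hn)
  have h2 := pos _ (nsmul_nonneg hv n)
  rw [map_add, map_add, h2] at h1
  linarith

end Helpers

section

variable {V : Type*} [AddCommGroup V] [PartialOrder V] [Module ℝ V]

/-- A state on the order-unit space `(V, v)`: a positive normalized linear functional. -/
def IsStateOUNS (v : V) (ρ : V →ₗ[ℝ] ℝ) : Prop :=
  (∀ a : V, 0 ≤ a → 0 ≤ ρ a) ∧ ρ v = 1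

/-- A state on the unit interval `E(V,v) = {a : 0 ≤ a ≤ v}`: a `[0,1]`-valued map
which is normalized and additive whenever the sum stays in the interval. -/
def IsStateInterval (v : V) (hv : 0 ≤ v) (ω : {a : V // 0 ≤ a ∧ a ≤ v} → ℝ) : Prop :=
  (∀ e, 0 ≤ ω e ∧ ω e ≤ 1) ∧ ω ⟨v, hv, le_refl v⟩ = 1 ∧
    ∀ (a b : {a : V // 0 ≤ a ∧ a ≤ v})
      (hab : 0 ≤ (a : V) + (b : V) ∧ (a : V) + (b : V) ≤ v),
      ω ⟨(a : V) + (b : V), hab⟩ = ω a + ω b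

/-- restriction is an affine bijection between states on `(V,v)` and
states on the unit interval `E(V,v)`. -/
theorem stmt_2
    (hadd : ∀ a b c : V, a ≤ b → a + c ≤ b + c)
    (hsmul : ∀ (α : ℝ) (a : V), 0 ≤ α → 0 ≤ a → 0 ≤ α • a)
    (v : V) (hv : 0 ≤ v)
    (hunit : ∀ a : V, ∃ n : ℕ, a ≤ n • v)
    (harch : ∀ a : V, (∃ b : V, ∀ n : ℕ, n • a ≤ b) → a ≤ 0) :
    Set.BijOn (fun (ρ : V →ₗ[ℝ] ℝ) => fun e : {a : V // 0 ≤ a ∧ a ≤ v} => ρ e)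
        {ρ : V →ₗ[ℝ] ℝ | IsStateOUNS v ρ}
        {ω : {a : V // 0 ≤ a ∧ a ≤ v} → ℝ | IsStateInterval v hv ω} ∧
      ∀ ρ₁ ρ₂ : V →ₗ[ℝ] ℝ, IsStateOUNS v ρ₁ → IsStateOUNS v ρ₂ →
        ∀ l : ℝ, 0 ≤ l → l ≤ 1 →
          (fun e : {a : V // 0 ≤ a ∧ a ≤ v} => (l • ρ₁ + (1 - l) • ρ₂) e) =
            l • (fun e : {a : V // 0 ≤ a ∧ a ≤ v} => ρ₁ e) +
              (1 - l) • (fun e : {a : V // 0 ≤ a ∧ a ≤ v} => ρ₂ e) := by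
  haveI : IsOrderedAddMonoid V :=
    { add_le_add_left := fun a b h c => by first | exact hadd a b c h | simpa [add_comm] using hadd a b c h }
  haveI : PosSMulMono ℝ V := PosSMulMono.of_smul_nonneg (fun α h0 a ha => hsmul α a h0 ha)
  haveI : IsOrderedModule ℝ V := IsOrderedModule.of_smul_nonneg (fun α h0 a ha => hsmul α a h0 ha)
  refine ⟨⟨?_, ?_, ?_⟩, ?_⟩
  · rintro ρ ⟨h0, h1⟩
    refine ⟨fun e => ⟨h0 _ e.2.1, ?_⟩, h1, fun a b hab => map_add ρ _ _⟩
    have := h0 _ (sub_nonneg.mpr e.2.2)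
    rw [map_sub, h1] at this
    show ρ e ≤ 1
    linarith
  · intro ρ _ σ _ h
    exact aux_inj v hv hunit ρ σ fun a ha hav => congrFun h ⟨a, ha, hav⟩
  · rintro ω ⟨hb, h1, hω⟩
    classical
    let f : V → ℝ := fun a => if h : 0 ≤ a ∧ a ≤ v then ω ⟨a, h⟩ else 0
    have hf : ∀ a (h : 0 ≤ a ∧ a ≤ v), f a = ω ⟨a, h⟩ := fun a h => dif_pos h
    obtain ⟨ρ, hρ0, hρ⟩ := aux_ext_s2 v f (by
        intro a b ha hb' hab
        have hA : 0 ≤ a ∧ a ≤ v := ⟨ha, (le_add_of_nonneg_right hb').trans hab⟩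
        have hB : 0 ≤ b ∧ b ≤ v := ⟨hb', (le_add_of_nonneg_left ha).trans hab⟩
        rw [hf a hA, hf b hB, hf (a + b) ⟨add_nonneg ha hb', hab⟩]
        exact hω ⟨a, hA⟩ ⟨b, hB⟩ _) hv
      (fun a ha hav => by rw [hf a ⟨ha, hav⟩]; exact (hb _).1)
      (by rw [hf v ⟨hv, le_rfl⟩]; exact h1) hunit
    refine ⟨ρ, ⟨hρ0, ?_⟩, ?_⟩
    · rw [hρ v hv le_rfl, hf v ⟨hv, le_rfl⟩]; exact h1
    · funext e
      show ρ e = ω e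
      rw [hρ e e.2.1 e.2.2, hf e e.2]
  · intro ρ₁ ρ₂ _ _ l _ _
    funext e
    simp

end
end

section
/- Let V be an Archimedean ordered real vector space with order unit v, and let E(V,v) = {a ∈ V : 0 ≤ a ≤ v}. A state ρ on (V,v) is an extreme point of the convex set of all states on (V,v) if and only if its restriction ρ|_{E(V,v)} is an extreme point of the convex set of all states on E(V,v). -/
section

variable {V : Type*} [AddCommGroup V] [PartialOrder V] [Module ℝ V]

section helpers

/-- A convenient packaging of interval states as total functions. -/
structure TotState (v : V) (W : V → ℝ) : Prop where
  nn : ∀ a, 0 ≤ a → a ≤ v → 0 ≤ W a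
  le1 : ∀ a, 0 ≤ a → a ≤ v → W a ≤ 1
  one : W v = 1
  add : ∀ a b, 0 ≤ a → 0 ≤ b → a + b ≤ v → W (a + b) = W a + W b

variable [IsOrderedAddMonoid V] [PosSMulMono ℝ V]

theorem smul_le_of {v e : V} (he : 0 ≤ e) (hev : e ≤ v) {t : ℝ} (ht1 : t ≤ 1) :
    t • e ≤ v := by
  have h : 0 ≤ (1 - t) • e := smul_nonneg (by linarith) he
  rw [sub_smul, one_smul, sub_nonneg] at h
  exact h.trans hev

theorem TotState.nat {v : V} {W : V → ℝ} (h : TotState v W) {x : V} (hx : 0 ≤ x) (k : ℕ) 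
    (hk : (k : ℝ) • x ≤ v) (h0 : 0 ≤ v) : W ((k : ℝ) • x) = k * W x := by
  induction k with
  | zero =>
    have := h.add 0 0 le_rfl le_rfl (by simpa using h0)
    simp at this ⊢
    exact this
  | succ k ih =>
    have e : ((k + 1 : ℕ) : ℝ) • x = (k : ℝ) • x + x := by
      push_cast; rw [add_smul, one_smul]
    rw [e] at hk ⊢
    have hkx : 0 ≤ (k : ℝ) • x := smul_nonneg (by positivity) hx
    rw [h.add _ _ hkx hx hk, ih ((le_add_of_nonneg_right hx).trans hk)]
    push_cast; ring

theorem TotState.smul {v : V} {W : V → ℝ} (h : TotState v W) {e : V} (he : 0 ≤ e) (hev : e ≤ v)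
    {t : ℝ} (ht0 : 0 ≤ t) (ht1 : t ≤ 1) : W (t • e) = t * W e := by
  have hv : 0 ≤ v := he.trans hev
  have key : ∀ n : ℕ, 0 < n → |W (t • e) - t * W e| ≤ 1 / n := by
    intro n hn
    have hn' : (0 : ℝ) < n := by exact_mod_cast hn
    set x : V := (1 / n : ℝ) • e with hx
    have hx0 : 0 ≤ x := smul_nonneg (by positivity) he
    have hnx : (n : ℝ) • x = e := by
      rw [hx, smul_smul, mul_one_div_cancel hn'.ne', one_smul]
    have hWe : W e = n * W x := by
      have := h.nat hx0 n (by rw [hnx]; exact hev) hv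
      rwa [hnx] at this
    set k := ⌊t * n⌋₊ with hk
    have hk1 : (k : ℝ) ≤ t * n := Nat.floor_le (by positivity)
    have hk2 : t * n < k + 1 := Nat.lt_floor_add_one _
    have hr0 : 0 ≤ t * n - k := by linarith
    have hr1 : 0 ≤ 1 - (t * n - k) := by linarith
    have hte : t • e = (k : ℝ) • x + (t * n - k) • x := by
      rw [← add_smul, ← hnx, smul_smul]; congr 1; ring
    have hxx : x = (t * n - k) • x + (1 - (t * n - k)) • x := by
      rw [← add_smul]; simp
    have htev : t • e ≤ v := smul_le_of he hev ht1
    have hxv : x ≤ v := smul_le_of he hev (by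
      rw [div_le_one hn']; exact_mod_cast hn)
    have a1 : 0 ≤ (k : ℝ) • x := smul_nonneg (by positivity) hx0
    have a2 : 0 ≤ (t * n - k) • x := smul_nonneg hr0 hx0
    have a3 : 0 ≤ (1 - (t * n - k)) • x := smul_nonneg hr1 hx0
    have e1 : W (t • e) = k * W x + W ((t * n - k) • x) := by
      rw [hte] at htev ⊢
      rw [h.add _ _ a1 a2 htev, h.nat hx0 k ((le_add_of_nonneg_right a2).trans htev) hv]
    have e2 : W x = W ((t * n - k) • x) + W ((1 - (t * n - k)) • x) := by
      rw [← h.add _ _ a2 a3 (by rw [← hxx]; exact hxv), ← hxx]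
    have b2 := h.nn _ a2 (smul_le_of hx0 hxv (by linarith))
    have b3 := h.nn _ a3 (smul_le_of hx0 hxv (by linarith))
    have b4 := h.nn _ hx0 hxv
    have b5 : W x ≤ 1 / n := by
      rw [le_div_iff₀ hn']
      have := h.le1 e he hev
      linarith
    have c1 : 0 ≤ (t * n - k) * W x := mul_nonneg hr0 b4
    have c2 : 0 ≤ (1 - (t * n - k)) * W x := mul_nonneg hr1 b4
    rw [e1, hWe, abs_le]
    constructor <;> nlinarith
  by_contra hne
  have hpos : 0 < |W (t • e) - t * W e| := abs_pos.mpr (sub_ne_zero.mpr hne)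
  obtain ⟨n, hn⟩ := exists_nat_one_div_lt hpos
  have := key (n + 1) (Nat.succ_pos n)
  push_cast at this
  linarith

/-- `s` rescales `a` into the interval, centred at `v/2`. -/
def Adm (v a : V) (s : ℝ) : Prop := 0 < s ∧ 0 ≤ s • a + (1/2 : ℝ) • v ∧ s • a + (1/2 : ℝ) • v ≤ v

theorem TotState.aff {v : V} {W : V → ℝ} (h : TotState v W) {e f : V} (he : 0 ≤ e) (hev : e ≤ v)
    (hf : 0 ≤ f) (hfv : f ≤ v) {t : ℝ} (ht0 : 0 ≤ t) (ht1 : t ≤ 1) :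
    0 ≤ t • e + (1 - t) • f ∧ t • e + (1 - t) • f ≤ v ∧
    W (t • e + (1 - t) • f) = t * W e + (1 - t) * W f := by
  have a1 : 0 ≤ t • e := smul_nonneg ht0 he
  have a2 : 0 ≤ (1 - t) • f := smul_nonneg (by linarith) hf
  have a3 : t • e + (1 - t) • f ≤ v := by
    have b1 : 0 ≤ t • (v - e) := smul_nonneg ht0 (sub_nonneg.mpr hev)
    have b2 : 0 ≤ (1 - t) • (v - f) := smul_nonneg (by linarith) (sub_nonneg.mpr hfv)
    have b3 := add_nonneg b1 b2
    rw [← sub_nonneg]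
    convert b3 using 1
    module
  refine ⟨add_nonneg a1 a2, a3, ?_⟩
  rw [h.add _ _ a1 a2 a3, h.smul he hev ht0 ht1, h.smul hf hfv (by linarith) (by linarith)]

theorem Adm.exists {v : V} (hv : 0 ≤ v) (hunit : ∀ a : V, ∃ n : ℕ, a ≤ n • v) (a : V) :
    ∃ s, Adm v a s := by
  obtain ⟨n, hn⟩ := hunit a
  obtain ⟨m, hm⟩ := hunit (-a)
  have h1 : 0 ≤ ((n : ℝ) + m + 1) • v - a := by
    have : 0 ≤ ((m : ℝ) + 1) • v := smul_nonneg (by positivity) hv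
    have h2 := add_nonneg this (sub_nonneg.mpr hn)
    rw [← Nat.cast_smul_eq_nsmul ℝ] at h2
    convert h2 using 1; module
  have h2 : 0 ≤ ((n : ℝ) + m + 1) • v + a := by
    have : 0 ≤ ((n : ℝ) + 1) • v := smul_nonneg (by positivity) hv
    have h2 := add_nonneg this (sub_nonneg.mpr hm)
    rw [← Nat.cast_smul_eq_nsmul ℝ] at h2
    convert h2 using 1; module
  have hN : (0 : ℝ) < (n : ℝ) + m + 1 := by positivity
  generalize (n : ℝ) + m + 1 = N at *
  refine ⟨1 / (2 * N), by positivity, ?_, ?_⟩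
  · have := smul_nonneg (show 0 ≤ 1 / (2 * N) by positivity) h2
    convert this using 1
    rw [smul_add, smul_smul, add_comm]
    congr 2; field_simp
  · have := smul_nonneg (show 0 ≤ 1 / (2 * N) by positivity) h1
    rw [← sub_nonneg]
    convert this using 1
    rw [smul_sub, smul_smul, show 1 / (2 * N) * N = 1/2 by field_simp]
    module

theorem half_mem {v : V} (hv : 0 ≤ v) : 0 ≤ (1/2 : ℝ) • v ∧ (1/2 : ℝ) • v ≤ v :=
  ⟨smul_nonneg (by norm_num) hv, smul_le_of hv le_rfl (by norm_num)⟩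

theorem TotState.half {v : V} (hv : 0 ≤ v) {W : V → ℝ} (h : TotState v W) :
    W ((1/2 : ℝ) • v) = 1/2 := by
  rw [h.smul hv le_rfl (by norm_num) (by norm_num), h.one]; norm_num

theorem Adm.mono {v : V} (hv : 0 ≤ v) {W : V → ℝ} (h : TotState v W) {a : V} {s s' : ℝ}
    (hs : Adm v a s) (h0 : 0 < s') (hle : s' ≤ s) :
    Adm v a s' ∧ (W (s' • a + (1/2 : ℝ) • v) - 1/2) / s' = (W (s • a + (1/2 : ℝ) • v) - 1/2) / s := by
  obtain ⟨p, q, r⟩ := hs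
  obtain ⟨x, y, z⟩ := h.aff q r (half_mem hv).1 (half_mem hv).2 (t := s' / s) (by positivity)
    (by rw [div_le_one p]; exact hle)
  have e : (s' / s) • (s • a + (1/2 : ℝ) • v) + (1 - s' / s) • (1/2 : ℝ) • v
      = s' • a + (1/2 : ℝ) • v := by
    rw [smul_add, smul_smul, div_mul_cancel₀ _ p.ne']; module
  rw [e] at x y z
  refine ⟨⟨h0, x, y⟩, ?_⟩
  rw [z, h.half hv]
  field_simp
  ring

theorem Adm.indep {v : V} (hv : 0 ≤ v) {W : V → ℝ} (h : TotState v W) {a : V} {s s' : ℝ}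
    (hs : Adm v a s) (hs' : Adm v a s') :
    (W (s' • a + (1/2 : ℝ) • v) - 1/2) / s' = (W (s • a + (1/2 : ℝ) • v) - 1/2) / s := by
  rcases le_total s' s with hh | hh
  · exact (hs.mono hv h hs'.1 hh).2
  · exact (hs'.mono hv h hs.1 hh).2.symm

theorem TotState.extend {v : V} (hv : 0 ≤ v) (hunit : ∀ a : V, ∃ n : ℕ, a ≤ n • v)
    {W : V → ℝ} (h : TotState v W) :
    ∃ σ : V →ₗ[ℝ] ℝ, IsStateOUNS v σ ∧ ∀ a, 0 ≤ a → a ≤ v → σ a = W a := by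
  choose S hS using Adm.exists hv hunit
  let g : V → ℝ := fun a => (W (S a • a + (1/2 : ℝ) • v) - 1/2) / S a
  have hg : ∀ a s, Adm v a s → g a = (W (s • a + (1/2 : ℝ) • v) - 1/2) / s :=
    fun a s hs => hs.indep hv h (hS a)
  have gadd : ∀ a b, g (a + b) = g a + g b := by
    intro a b
    have hs0 : 0 < min (S a) (S b) := lt_min (hS a).1 (hS b).1
    have ha := ((hS a).mono hv h hs0 (min_le_left _ _)).1
    have hb := ((hS b).mono hv h hs0 (min_le_right _ _)).1
    generalize min (S a) (S b) = s at *
    obtain ⟨x, y, z⟩ := h.aff ha.2.1 ha.2.2 hb.2.1 hb.2.2 (t := 1/2) (by norm_num) (by norm_num)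
    have e : (1/2 : ℝ) • (s • a + (1/2 : ℝ) • v) + (1 - 1/2 : ℝ) • (s • b + (1/2 : ℝ) • v)
        = (s / 2) • (a + b) + (1/2 : ℝ) • v := by module
    rw [e] at x y z
    rw [hg a s ha, hg b s hb, hg (a + b) (s / 2) ⟨by positivity, x, y⟩, z]
    field_simp
    ring
  have gpos : ∀ (c : ℝ) a, 0 < c → g (c • a) = c * g a := by
    intro c a hc
    have h1 := hS (c • a)
    rw [hg _ _ h1]
    generalize S (c • a) = s at *
    have h2 : Adm v a (s * c) := by
      refine ⟨mul_pos h1.1 hc, ?_, ?_⟩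
      · rw [mul_smul]; exact h1.2.1
      · rw [mul_smul]; exact h1.2.2
    have := h1.1
    rw [hg _ _ h2, mul_smul]
    field_simp
  have g0 : g 0 = 0 := by simpa using gadd 0 0
  have gneg : ∀ a, g (-a) = - g a := by
    intro a
    have := gadd a (-a)
    rw [add_neg_cancel, g0] at this
    linarith
  have gsmul : ∀ (c : ℝ) a, g (c • a) = c * g a := by
    intro c a
    rcases lt_trichotomy c 0 with hc | hc | hc
    · have := gpos (-c) a (by linarith)
      rw [neg_smul, gneg] at this
      linarith
    · subst hc; simp [g0]
    · exact gpos c a hc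
  have gext : ∀ a, 0 ≤ a → a ≤ v → g a = W a := by
    intro a ha hav
    obtain ⟨x, y, z⟩ := h.aff ha hav hv le_rfl (t := 1/2) (by norm_num) (by norm_num)
    rw [show (1 - 1/2 : ℝ) = 1/2 by norm_num] at x y z
    rw [hg a (1/2) ⟨by norm_num, x, y⟩, z, h.one]
    ring
  refine ⟨{ toFun := g, map_add' := gadd, map_smul' := gsmul }, ⟨?_, ?_⟩, gext⟩
  · intro a ha
    have hs := hS a
    have p : 0 ≤ S a • a := smul_nonneg hs.1.le ha
    have q := half_mem hv
    show 0 ≤ (W (S a • a + (1/2 : ℝ) • v) - 1/2) / S a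
    rw [h.add _ _ p q.1 hs.2.2, h.half hv]
    have := h.nn _ p ((le_add_of_nonneg_right q.1).trans hs.2.2)
    exact div_nonneg (by linarith) hs.1.le
  · exact (gext v hv le_rfl).trans h.one

theorem lin_ext {v : V} (hv : 0 ≤ v) (hunit : ∀ a : V, ∃ n : ℕ, a ≤ n • v)
    {σ τ : V →ₗ[ℝ] ℝ} (h : ∀ a, 0 ≤ a → a ≤ v → σ a = τ a) : σ = τ := by
  ext a
  obtain ⟨s, h0, h1, h2⟩ := Adm.exists hv hunit a
  have e := h _ h1 h2
  have e' := h v hv le_rfl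
  simp only [map_add, map_smul, smul_eq_mul, e'] at e
  have : s * σ a = s * τ a := by linarith
  exact mul_left_cancel₀ h0.ne' this

theorem IsStateInterval.extend {v : V} (hv : 0 ≤ v) (hunit : ∀ a : V, ∃ n : ℕ, a ≤ n • v)
    {ω : {a : V // 0 ≤ a ∧ a ≤ v} → ℝ} (h : IsStateInterval v hv ω) :
    ∃ σ : V →ₗ[ℝ] ℝ, IsStateOUNS v σ ∧ (fun e : {a : V // 0 ≤ a ∧ a ≤ v} => σ e) = ω := by
  classical
  obtain ⟨h1, h2, h3⟩ := h
  let W : V → ℝ := fun a => if ha : 0 ≤ a ∧ a ≤ v then ω ⟨a, ha⟩ else 0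
  have hW : ∀ a (ha : 0 ≤ a ∧ a ≤ v), W a = ω ⟨a, ha⟩ := fun a ha => dif_pos ha
  have hT : TotState v W := by
    refine ⟨?_, ?_, ?_, ?_⟩
    · intro a ha hb; rw [hW a ⟨ha, hb⟩]; exact (h1 _).1
    · intro a ha hb; rw [hW a ⟨ha, hb⟩]; exact (h1 _).2
    · rw [hW v ⟨hv, le_rfl⟩]; exact h2
    · intro a b ha hb hab
      have hA : 0 ≤ a ∧ a ≤ v := ⟨ha, (le_add_of_nonneg_right hb).trans hab⟩
      have hB : 0 ≤ b ∧ b ≤ v := ⟨hb, (le_add_of_nonneg_left ha).trans hab⟩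
      rw [hW a hA, hW b hB, hW (a + b) ⟨add_nonneg ha hb, hab⟩]
      exact h3 ⟨a, hA⟩ ⟨b, hB⟩ _
  obtain ⟨σ, hσ, hE⟩ := hT.extend hv hunit
  refine ⟨σ, hσ, ?_⟩
  funext e
  rw [hE e e.2.1 e.2.2, hW e e.2]

theorem IsStateOUNS.restrict {v : V} (hv : 0 ≤ v) {σ : V →ₗ[ℝ] ℝ} (h : IsStateOUNS v σ) :
    IsStateInterval v hv (fun e : {a : V // 0 ≤ a ∧ a ≤ v} => σ e) := by
  refine ⟨fun e => ⟨h.1 _ e.2.1, ?_⟩, h.2, fun a b _ => map_add σ _ _⟩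
  have := h.1 _ (sub_nonneg.mpr e.2.2)
  rw [map_sub, h.2] at this
  linarith

end helpers

/-- a state on `(V,v)` is an extreme point of the state space iff its
restriction to the unit interval `E(V,v)` is an extreme point of the states on `E(V,v)`. -/
theorem stmt_3
    (hadd : ∀ a b c : V, a ≤ b → a + c ≤ b + c)
    (hsmul : ∀ (α : ℝ) (a : V), 0 ≤ α → 0 ≤ a → 0 ≤ α • a)
    (v : V) (hv : 0 ≤ v)
    (hunit : ∀ a : V, ∃ n : ℕ, a ≤ n • v)
    (harch : ∀ a : V, (∃ b : V, ∀ n : ℕ, n • a ≤ b) → a ≤ 0)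
    (ρ : V →ₗ[ℝ] ℝ) (hρ : IsStateOUNS v ρ) :
    ρ ∈ Set.extremePoints ℝ {ρ' : V →ₗ[ℝ] ℝ | IsStateOUNS v ρ'} ↔
      (fun e : {a : V // 0 ≤ a ∧ a ≤ v} => ρ e) ∈
        Set.extremePoints ℝ
          {ω : {a : V // 0 ≤ a ∧ a ≤ v} → ℝ | IsStateInterval v hv ω} := by
  haveI : IsOrderedAddMonoid V :=
    { add_le_add_left := fun a b hab c => hadd a b c hab }
  haveI : PosSMulMono ℝ V := PosSMulMono.of_smul_nonneg fun α hα a ha => hsmul α a hα ha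
  simp only [mem_extremePoints_iff_left, Set.mem_setOf_eq]
  constructor
  · rintro ⟨-, hext⟩
    refine ⟨hρ.restrict hv, ?_⟩
    rintro ω₁ h₁ ω₂ h₂ ⟨a, b, ha, hb, hab, he⟩
    obtain ⟨σ₁, hσ₁, rfl⟩ := h₁.extend hv hunit
    obtain ⟨σ₂, hσ₂, rfl⟩ := h₂.extend hv hunit
    have : σ₁ = ρ := hext σ₁ hσ₁ σ₂ hσ₂ ⟨a, b, ha, hb, hab, lin_ext hv hunit
      fun x hx hxv => congrFun he ⟨x, hx, hxv⟩⟩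
    rw [this]
  · rintro ⟨-, hext⟩
    refine ⟨hρ, ?_⟩
    rintro σ₁ h₁ σ₂ h₂ ⟨a, b, ha, hb, hab, he⟩
    have := hext _ (h₁.restrict hv) _ (h₂.restrict hv) ⟨a, b, ha, hb, hab, by
      funext e; rw [← he]; rfl⟩
    exact lin_ext hv hunit fun x hx hxv => congrFun this ⟨x, hx, hxv⟩


end
end

section
/- Let V be an Archimedean ordered real vector space with order unit v, and let a ∈ V. Then 0 ≤ a if and only if ρ(a) ≥ 0 for every state ρ on (V,v). -/
/-- in an Archimedean order-unit space, `0 ≤ a` iff every state takes a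
nonnegative value at `a`. -/
theorem stmt_4
    {V : Type*} [AddCommGroup V] [PartialOrder V] [Module ℝ V]
    (hadd : ∀ a b c : V, a ≤ b → a + c ≤ b + c)
    (hsmul : ∀ (α : ℝ) (a : V), 0 ≤ α → 0 ≤ a → 0 ≤ α • a)
    (v : V) (hv : 0 ≤ v)
    (hunit : ∀ a : V, ∃ n : ℕ, a ≤ n • v)
    (harch : ∀ a : V, (∃ b : V, ∀ n : ℕ, n • a ≤ b) → a ≤ 0)
    (a : V) :
    0 ≤ a ↔ ∀ ρ : V →ₗ[ℝ] ℝ, ((∀ b : V, 0 ≤ b → 0 ≤ ρ b) ∧ ρ v = 1) → 0 ≤ ρ a := by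
  have : IsOrderedAddMonoid V :=
    { add_le_add_left := fun a b h c => hadd a b c h }
  constructor
  · intro ha ρ hρ
    exact hρ.1 a ha
  intro h
  by_contra hna
  -- `v` is nonzero
  have hv0 : v ≠ 0 := by
    rintro rfl
    obtain ⟨n, hn⟩ := hunit (-a)
    rw [smul_zero] at hn
    exact hna (neg_nonpos.mp hn)
  -- some `v + n a` is not positive
  obtain ⟨n, hn⟩ : ∃ n : ℕ, ¬ (0 ≤ v + n • a) := by
    by_contra hcon
    push Not at hcon
    refine hna (neg_nonpos.mp (harch (-a) ⟨v, fun n => ?_⟩))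
    have h1 := hcon n
    rw [smul_neg]
    exact neg_le_iff_add_nonneg.mpr h1
  set b := v + n • a with hb
  let s : PointedCone ℝ V :=
    { carrier := {x | ∃ c : ℝ, 0 ≤ c ∧ 0 ≤ x + c • b}
      zero_mem' := ⟨0, le_rfl, by simp⟩
      add_mem' := by
        rintro x y ⟨c, hc, hx⟩ ⟨d, hd, hy⟩
        refine ⟨c + d, add_nonneg hc hd, ?_⟩
        have h1 := add_nonneg hx hy
        have h2 : x + y + (c + d) • b = x + c • b + (y + d • b) := by module
        rw [h2]
        exact h1
      smul_mem' := by
        rintro ⟨r, hr⟩ x ⟨c, hc, hx⟩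
        refine ⟨r * c, mul_nonneg hr hc, ?_⟩
        have h1 := hsmul r _ hr hx
        rw [smul_add, smul_smul] at h1
        exact h1 }
  have hs : ∀ x, x ∈ s ↔ ∃ c : ℝ, 0 ≤ c ∧ 0 ≤ x + c • b := fun x => Iff.rfl
  have key : ∀ t : ℝ, t • v ∈ s → 0 ≤ t := by
    intro t ht
    obtain ⟨c, hc, hx⟩ := (hs _).1 ht
    by_contra htn
    push Not at htn
    rcases hc.eq_or_lt with rfl | hc
    · rw [zero_smul, add_zero] at hx
      have h1 := hsmul (-t)⁻¹ _ (inv_nonneg.mpr (by linarith)) hx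
      rw [smul_smul, inv_neg, neg_mul, inv_mul_cancel₀ htn.ne, neg_smul, one_smul] at h1
      exact hv0 (le_antisymm (neg_nonneg.mp h1) hv)
    · have h2 : 0 ≤ c • b := by
        have h3 := add_nonneg hx (hsmul (-t) v (by linarith) hv)
        have h4 : t • v + c • b + (-t) • v = c • b := by module
        rwa [h4] at h3
      have h1 := hsmul c⁻¹ _ (inv_nonneg.mpr hc.le) h2
      rw [smul_smul, inv_mul_cancel₀ hc.ne', one_smul] at h1
      exact hn h1
  let f : V →ₗ.[ℝ] ℝ := LinearPMap.mkSpanSingleton v (1 : ℝ) hv0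
  have hf : ∀ (t : ℝ) (ht : t • v ∈ f.domain), f ⟨t • v, ht⟩ = t := by
    intro t ht
    have := LinearPMap.mkSpanSingleton'_apply (R := ℝ) v (1 : ℝ)
      (fun c hc => by
        rcases smul_eq_zero.mp hc with h | h
        · simp [h]
        · exact absurd h hv0) t ht
    exact this.trans (mul_one t)
  have hdom : ∀ t : ℝ, t • v ∈ f.domain := fun t =>
    Submodule.smul_mem _ t (Submodule.mem_span_singleton_self v)
  obtain ⟨g, hgf, hgs⟩ := riesz_extension s f
    (by
      rintro ⟨x, hx⟩ hxs
      obtain ⟨t, rfl⟩ := Submodule.mem_span_singleton.mp hx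
      rw [hf]
      exact key t hxs)
    (by
      intro y
      obtain ⟨m, hm⟩ := hunit (-y)
      refine ⟨⟨(m : ℝ) • v, hdom _⟩, (hs _).2 ⟨0, le_rfl, ?_⟩⟩
      rw [zero_smul, add_zero]
      change 0 ≤ (m : ℝ) • v + y
      rw [Nat.cast_smul_eq_nsmul]
      exact neg_le_iff_add_nonneg.mp hm)
  have hgv : g v = 1 := by
    have h1 := hgf ⟨(1 : ℝ) • v, hdom 1⟩
    rw [hf] at h1
    simpa using h1
  have hga := h g ⟨fun x hx => hgs x ((hs x).2 ⟨0, le_rfl, by simpa using hx⟩), hgv⟩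
  have hgb := hgs (-b) ((hs _).2 ⟨1, zero_le_one, by simp⟩)
  rw [hb, map_neg, map_add, map_nsmul, hgv, nsmul_eq_mul] at hgb
  have : 0 ≤ (n : ℝ) * g a := by positivity
  linarith
end

section
/- Let V be an Archimedean ordered real vector space with order unit v, and for a ∈ V let ‖a‖ denote the order-unit norm ‖a‖ = inf{λ ∈ ℝ : 0 < λ, -λ•v ≤ a and a ≤ λ•v}. Then for every a ∈ V, ‖a‖ = sup{|ρ(a)| : ρ is a state on (V,v)}. -/
theorem exists_state_aux
    {V : Type*} [AddCommGroup V] [PartialOrder V] [Module ℝ V] [IsOrderedAddMonoid V]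
    (hsmul : ∀ (α : ℝ) (a : V), 0 ≤ α → 0 ≤ a → 0 ≤ α • a)
    (v : V) (hv : 0 ≤ v) (hv0 : v ≠ 0)
    (hunit : ∀ a : V, ∃ n : ℕ, a ≤ n • v) (c : V) (hc : ¬ 0 ≤ c) :
    ∃ ρ : V →ₗ[ℝ] ℝ, ((∀ b : V, 0 ≤ b → 0 ≤ ρ b) ∧ ρ v = 1) ∧ ρ c ≤ 0 := by
  let K : PointedCone ℝ V :=
    { carrier := {y | ∃ s : ℝ, 0 ≤ s ∧ 0 ≤ y + s • c}
      zero_mem' := ⟨0, le_rfl, by simp⟩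
      smul_mem' := by
        rintro ⟨r, hr⟩ x ⟨s, hs, h⟩
        refine ⟨r * s, mul_nonneg hr hs, ?_⟩
        have := hsmul r _ hr h
        rw [smul_add, smul_smul] at this
        exact this
      add_mem' := by
        rintro x y ⟨s, hs, h⟩ ⟨t, ht, h'⟩
        refine ⟨s + t, add_nonneg hs ht, ?_⟩
        have := add_nonneg h h'
        rw [add_smul]
        convert this using 1
        abel }
  have hP : ∀ b : V, 0 ≤ b → b ∈ K := fun b hb => ⟨0, le_rfl, by simpa using hb⟩
  obtain ⟨g, hg, hgK⟩ := riesz_extension K (LinearPMap.mkSpanSingleton v (1 : ℝ) hv0) (by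
      rintro ⟨x, hx⟩ hxK
      obtain ⟨t, rfl⟩ := Submodule.mem_span_singleton.1 hx
      rw [LinearPMap.mkSpanSingleton'_apply]
      obtain ⟨s, hs, h⟩ := hxK
      simp only [smul_eq_mul, mul_one, RingHom.id_apply]
      by_contra! ht
      have h1 : 0 ≤ (-t) • v := hsmul _ _ (by linarith) hv
      have h2 : 0 ≤ s • c := by
        have := add_nonneg h h1
        convert this using 1
        simp only [neg_smul]
        abel
      rcases hs.eq_or_lt with rfl | hs
      · have h3 : 0 ≤ (-t)⁻¹ • (t • v) := hsmul _ _ (by rw [inv_nonneg]; linarith) (by simpa using h)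
        rw [smul_smul, inv_neg, neg_mul, inv_mul_cancel₀ ht.ne, neg_smul, one_smul] at h3
        exact hv0 (le_antisymm (by simpa using h3) hv)
      · apply hc
        have h3 := hsmul s⁻¹ _ (by positivity) h2
        rwa [smul_smul, inv_mul_cancel₀ hs.ne', one_smul] at h3) (by
      intro y
      obtain ⟨n, hn⟩ := hunit (-y)
      refine ⟨⟨n • v, Submodule.smul_of_tower_mem _ n (Submodule.mem_span_singleton_self v)⟩, hP _ ?_⟩
      exact neg_le_iff_add_nonneg.1 hn)
  refine ⟨g, ⟨fun b hb => hgK b (hP b hb), ?_⟩, ?_⟩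
  · have := hg ⟨v, Submodule.mem_span_singleton_self v⟩
    rw [LinearPMap.mkSpanSingleton_apply] at this
    exact this
  · have := hgK (-c) ⟨1, zero_le_one, by simp⟩
    rw [map_neg] at this
    linarith

/-- in an Archimedean order-unit space, the order-unit norm of `a` equals
the supremum of `|ρ(a)|` over all states `ρ`. -/
theorem stmt_5
    {V : Type*} [AddCommGroup V] [PartialOrder V] [Module ℝ V]
    (hadd : ∀ a b c : V, a ≤ b → a + c ≤ b + c)
    (hsmul : ∀ (α : ℝ) (a : V), 0 ≤ α → 0 ≤ a → 0 ≤ α • a)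
    (v : V) (hv : 0 ≤ v)
    (hunit : ∀ a : V, ∃ n : ℕ, a ≤ n • v)
    (harch : ∀ a : V, (∃ b : V, ∀ n : ℕ, n • a ≤ b) → a ≤ 0) :
    ∀ a : V,
      sInf {l : ℝ | 0 < l ∧ -(l • v) ≤ a ∧ a ≤ l • v} =
        sSup {r : ℝ | ∃ ρ : V →ₗ[ℝ] ℝ,
          ((∀ b : V, 0 ≤ b → 0 ≤ ρ b) ∧ ρ v = 1) ∧ r = |ρ a|} := by
  intro a
  have : IsOrderedAddMonoid V := ⟨fun a b h c => by simpa only [add_comm] using hadd a b c h,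
    fun a b h c => by simpa only [add_comm] using hadd a b c h⟩
  by_cases hv0 : v = 0
  · subst hv0
    have hz : ∀ b : V, b ≤ 0 := fun b => by simpa using hunit b
    have ha : a = 0 := le_antisymm (hz a) (by simpa using hz (-a))
    subst ha
    have h1 : {l : ℝ | 0 < l ∧ -(l • (0 : V)) ≤ 0 ∧ 0 ≤ l • (0 : V)} = Set.Ioi 0 := by
      ext; simp
    rw [h1, csInf_Ioi]
    simp
  have mono : ∀ (s t : ℝ), s ≤ t → s • v ≤ t • v := fun s t h => by
    have := hsmul (t - s) v (by linarith) hv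
    rw [sub_smul] at this
    exact sub_nonneg.1 this
  have hle : ∀ l : ℝ, (0 < l ∧ -(l • v) ≤ a ∧ a ≤ l • v) → ∀ ρ : V →ₗ[ℝ] ℝ,
      ((∀ b : V, 0 ≤ b → 0 ≤ ρ b) ∧ ρ v = 1) → |ρ a| ≤ l := by
    rintro l ⟨-, h1, h2⟩ ρ ⟨hp, h⟩
    have e1 := hp _ (sub_nonneg.2 h1)
    have e2 := hp _ (sub_nonneg.2 h2)
    simp only [map_sub, map_neg, map_smul, h, smul_eq_mul] at e1 e2
    rw [abs_le]
    constructor <;> linarith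
  obtain ⟨n, hn⟩ := hunit a
  obtain ⟨m, hm⟩ := hunit (-a)
  rw [← Nat.cast_smul_eq_nsmul ℝ] at hn hm
  have hne : (0 : ℝ) < n + m + 1 ∧ -(((n : ℝ) + m + 1) • v) ≤ a ∧ a ≤ ((n : ℝ) + m + 1) • v := by
    have hn0 : (0 : ℝ) ≤ n := n.cast_nonneg
    have hm0 : (0 : ℝ) ≤ m := m.cast_nonneg
    exact ⟨by positivity, neg_le.1 (hm.trans (mono _ _ (by linarith))),
      hn.trans (mono _ _ (by linarith))⟩
  have hbdd : BddAbove {r : ℝ | ∃ ρ : V →ₗ[ℝ] ℝ,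
          ((∀ b : V, 0 ≤ b → 0 ≤ ρ b) ∧ ρ v = 1) ∧ r = |ρ a|} := by
    refine ⟨(n : ℝ) + m + 1, ?_⟩
    rintro r ⟨ρ, hρ, rfl⟩
    exact hle _ hne ρ hρ
  apply le_antisymm
  · apply le_of_forall_gt_imp_ge_of_dense
    intro l hl
    have hS : 0 ≤ sSup {r : ℝ | ∃ ρ : V →ₗ[ℝ] ℝ,
          ((∀ b : V, 0 ≤ b → 0 ≤ ρ b) ∧ ρ v = 1) ∧ r = |ρ a|} := by
      apply Real.sSup_nonneg
      rintro r ⟨ρ, -, rfl⟩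
      exact abs_nonneg _
    have key : ∀ ρ : V →ₗ[ℝ] ℝ, ((∀ b : V, 0 ≤ b → 0 ≤ ρ b) ∧ ρ v = 1) → |ρ a| < l :=
      fun ρ hρ => (le_csSup hbdd ⟨ρ, hρ, rfl⟩).trans_lt hl
    refine csInf_le ⟨0, fun x hx => hx.1.le⟩ ⟨by linarith, ?_, ?_⟩
    · by_contra h
      obtain ⟨ρ, hρ, h'⟩ := exists_state_aux hsmul v hv hv0 hunit (a - -(l • v))
        (fun h' => h (sub_nonneg.1 h'))
      have := abs_lt.1 (key ρ hρ)
      simp only [map_sub, map_neg, map_smul, hρ.2, smul_eq_mul] at h'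
      linarith
    · by_contra h
      obtain ⟨ρ, hρ, h'⟩ := exists_state_aux hsmul v hv hv0 hunit (l • v - a)
        (fun h' => h (sub_nonneg.1 h'))
      have := abs_lt.1 (key ρ hρ)
      simp only [map_sub, map_smul, hρ.2, smul_eq_mul] at h'
      linarith
  · refine le_csInf ⟨(n : ℝ) + m + 1, hne⟩ ?_
    intro l hl
    apply Real.sSup_le _ hl.1.le
    rintro r ⟨ρ, hρ, rfl⟩
    exact hle l hl ρ hρ
end

section
/- Let V be an Archimedean ordered real vector space with order unit v, with order-unit norm ‖a‖ = inf{λ ∈ ℝ : 0 < λ, -λ•v ≤ a and a ≤ λ•v}, and let ρ : V → ℝ be a linear functional. Then ρ is positive (ρ(a) ≥ 0 whenever 0 ≤ a) if and only if ρ is bounded with operator norm equal to ρ(v), i.e., |ρ(a)| ≤ ρ(v)·‖a‖ for all a ∈ V and ρ(v) = sup{|ρ(a)| : a ∈ V, ‖a‖ ≤ 1}. -/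
/-- a linear functional on an Archimedean order-unit space is positive iff
it is bounded with operator norm equal to its value at the order unit. Here
`sInf {l | 0 < l ∧ -(l • v) ≤ a ∧ a ≤ l • v}` is the order-unit norm of `a`. -/
theorem stmt_6
    {V : Type*} [AddCommGroup V] [PartialOrder V] [Module ℝ V]
    (hadd : ∀ a b c : V, a ≤ b → a + c ≤ b + c)
    (hsmul : ∀ (α : ℝ) (a : V), 0 ≤ α → 0 ≤ a → 0 ≤ α • a)
    (v : V) (hv : 0 ≤ v)
    (hunit : ∀ a : V, ∃ n : ℕ, a ≤ n • v)
    (harch : ∀ a : V, (∃ b : V, ∀ n : ℕ, n • a ≤ b) → a ≤ 0)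
    (ρ : V →ₗ[ℝ] ℝ) :
    (∀ a : V, 0 ≤ a → 0 ≤ ρ a) ↔
      ((∀ a : V, |ρ a| ≤ ρ v * sInf {l : ℝ | 0 < l ∧ -(l • v) ≤ a ∧ a ≤ l • v}) ∧
        ρ v = sSup {r : ℝ | ∃ a : V,
          sInf {l : ℝ | 0 < l ∧ -(l • v) ≤ a ∧ a ≤ l • v} ≤ 1 ∧ r = |ρ a|}) := by
  haveI : IsOrderedAddMonoid V :=
    { add_le_add_left := fun a b h c => hadd a b c h }
  have hmono : ∀ l m : ℝ, l ≤ m → l • v ≤ m • v := by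
    intro l m h
    have h1 := hsmul (m - l) v (by linarith) hv
    rw [sub_smul] at h1
    exact sub_nonneg.mp h1
  have hne : ∀ a : V, ∃ l : ℝ, 0 < l ∧ -(l • v) ≤ a ∧ a ≤ l • v := by
    intro a
    obtain ⟨n, hn⟩ := hunit a
    obtain ⟨m, hm⟩ := hunit (-a)
    rw [← Nat.cast_smul_eq_nsmul ℝ] at hn hm
    have hn0 : (0 : ℝ) ≤ n := Nat.cast_nonneg n
    have hm0 : (0 : ℝ) ≤ m := Nat.cast_nonneg m
    refine ⟨n + m + 1, by linarith, ?_, ?_⟩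
    · exact neg_le.mp (hm.trans (hmono _ _ (by linarith)))
    · exact hn.trans (hmono _ _ (by linarith))
  have hbdd : ∀ a : V, BddBelow {l : ℝ | 0 < l ∧ -(l • v) ≤ a ∧ a ≤ l • v} :=
    fun a => ⟨0, fun l hl => hl.1.le⟩
  constructor
  · intro hpos
    have hv0 := hpos v hv
    have hB : ∀ a : V,
        |ρ a| ≤ ρ v * sInf {l : ℝ | 0 < l ∧ -(l • v) ≤ a ∧ a ≤ l • v} := by
      intro a
      have key : ∀ l : ℝ, -(l • v) ≤ a → a ≤ l • v → |ρ a| ≤ ρ v * l := by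
        intro l h1 h2
        have e1 := hpos _ (sub_nonneg.mpr h1)
        have e2 := hpos _ (sub_nonneg.mpr h2)
        simp only [map_sub, map_neg, map_smul, smul_eq_mul] at e1 e2
        rw [abs_le]
        constructor <;> linarith
      rcases hv0.eq_or_lt with h0 | h0
      · obtain ⟨l, _, h1, h2⟩ := hne a
        have := key l h1 h2
        rw [← h0] at this ⊢
        simpa using this
      · rw [← div_le_iff₀' h0]
        refine le_csInf (hne a) ?_
        rintro l ⟨_, h1, h2⟩
        rw [div_le_iff₀' h0]
        exact key l h1 h2
    refine ⟨hB, ?_⟩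
    symm
    apply IsGreatest.csSup_eq
    constructor
    · refine ⟨v, csInf_le (hbdd v) ⟨one_pos, ?_, ?_⟩, (abs_of_nonneg hv0).symm⟩
      · rw [one_smul]
        exact (neg_nonpos.mpr hv).trans hv
      · rw [one_smul]
    · rintro r ⟨a, ha, rfl⟩
      exact (hB a).trans (mul_le_of_le_one_right hv0 ha)
  · rintro ⟨hB, hS⟩ a ha
    have hv0 : 0 ≤ ρ v := by
      rw [hS]
      apply Real.sSup_nonneg
      rintro r ⟨a, _, rfl⟩
      exact abs_nonneg _
    obtain ⟨l, hl, _, h2⟩ := hne a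
    have h3 : sInf {k : ℝ | 0 < k ∧ -(k • v) ≤ l • v - a ∧ l • v - a ≤ k • v} ≤ l := by
      refine csInf_le (hbdd _) ⟨hl, ?_, sub_le_self _ ha⟩
      exact (neg_nonpos.mpr (hsmul l v hl.le hv)).trans (sub_nonneg.mpr h2)
    have h4 := (le_abs_self _).trans ((hB (l • v - a)).trans (mul_le_mul_of_nonneg_left h3 hv0))
    simp only [map_sub, map_smul, smul_eq_mul] at h4
    linarith
end

section
/- Let V be an Archimedean ordered real vector space with order unit v, and let V₁ be a linear subspace of V with v ∈ V₁, equipped with the induced order (for which v is again an order unit). Then every state ρ₁ on (V₁,v) can be extended to a state ρ on (V,v), i.e., there exists a state ρ on (V,v) whose restriction to V₁ equals ρ₁; moreover, the restriction to V₁ of any state on (V,v) is a state on (V₁,v). -/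
/-- every state on a linear subspace `V₁` of an Archimedean order-unit
space `(V,v)` with `v ∈ V₁` (with the induced order) extends to a state on `(V,v)`;
moreover restriction of any state on `(V,v)` is a state on `(V₁,v)`. -/
theorem stmt_7
    {V : Type*} [AddCommGroup V] [PartialOrder V] [Module ℝ V]
    (hadd : ∀ a b c : V, a ≤ b → a + c ≤ b + c)
    (hsmul : ∀ (α : ℝ) (a : V), 0 ≤ α → 0 ≤ a → 0 ≤ α • a)
    (v : V) (hv : 0 ≤ v)
    (hunit : ∀ a : V, ∃ n : ℕ, a ≤ n • v)
    (harch : ∀ a : V, (∃ b : V, ∀ n : ℕ, n • a ≤ b) → a ≤ 0)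
    (V₁ : Submodule ℝ V) (hv1 : v ∈ V₁) :
    (∀ ρ₁ : V₁ →ₗ[ℝ] ℝ,
      ((∀ x : V₁, 0 ≤ (x : V) → 0 ≤ ρ₁ x) ∧ ρ₁ ⟨v, hv1⟩ = 1) →
        ∃ ρ : V →ₗ[ℝ] ℝ,
          ((∀ a : V, 0 ≤ a → 0 ≤ ρ a) ∧ ρ v = 1) ∧ ∀ x : V₁, ρ (x : V) = ρ₁ x) ∧
      ∀ ρ : V →ₗ[ℝ] ℝ, ((∀ a : V, 0 ≤ a → 0 ≤ ρ a) ∧ ρ v = 1) →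
        ((∀ x : V₁, 0 ≤ (x : V) → 0 ≤ (ρ.comp V₁.subtype) x) ∧
          (ρ.comp V₁.subtype) ⟨v, hv1⟩ = 1) := by
  refine ⟨?_, fun ρ h => ⟨fun x hx => h.1 x hx, h.2⟩⟩
  rintro ρ₁ ⟨hpos, hone⟩
  let s : PointedCone ℝ V :=
    { carrier := {a | 0 ≤ a}
      add_mem' := by
        intro a b ha hb
        have h := hadd 0 a b ha
        rw [zero_add] at h
        exact le_trans hb h
      zero_mem' := le_refl (0 : V)
      smul_mem' := fun c a ha => hsmul c.1 a c.2 ha }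
  obtain ⟨g, hg, hgs⟩ := riesz_extension s ⟨V₁, ρ₁⟩ (fun x hx => hpos x hx) (by
    intro y
    obtain ⟨n, hn⟩ := hunit (-y)
    refine ⟨⟨n • v, V₁.nsmul_mem hv1 n⟩, ?_⟩
    have h := hadd _ _ y hn
    rw [neg_add_cancel] at h
    exact h)
  exact ⟨g, ⟨fun a ha => hgs a ha, (hg ⟨v, hv1⟩).trans hone⟩, fun x => hg x⟩
end

section
/- Let X be a compact Hausdorff topological space. A state γ on C(X,ℝ) is an extreme point of the convex set of all states on C(X,ℝ) if and only if there exists x ∈ X such that γ(f) = f(x) for all f ∈ C(X,ℝ). -/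
theorem aux_mul
    {X : Type*} [TopologicalSpace X] [CompactSpace X] [T2Space X]
    (γ : C(X, ℝ) →ₗ[ℝ] ℝ)
    (h : γ ∈ Set.extremePoints ℝ {γ' : C(X, ℝ) →ₗ[ℝ] ℝ |
        (∀ f : C(X, ℝ), (∀ x, 0 ≤ f x) → 0 ≤ γ' f) ∧ γ' 1 = 1})
    (g : C(X, ℝ)) (h1 : ∀ x, 1 / 4 ≤ g x) (h2 : ∀ x, g x ≤ 3 / 4) (f : C(X, ℝ)) :
    γ (f * g) = γ f * γ g := by
  obtain ⟨⟨hp, h11⟩, hext⟩ := h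
  have t1 : 1 / 4 ≤ γ g := by
    have := hp (g - (1 / 4 : ℝ) • 1) (fun x => by simpa using h1 x)
    rw [map_sub, map_smul, h11, smul_eq_mul] at this
    linarith
  have t2 : γ g ≤ 3 / 4 := by
    have := hp ((3 / 4 : ℝ) • 1 - g) (fun x => by simpa using h2 x)
    rw [map_sub, map_smul, h11, smul_eq_mul] at this
    linarith
  have hpos : 0 < γ g := by linarith
  have hpos' : 0 < 1 - γ g := by linarith
  have key := hext
    (x₁ := (γ g)⁻¹ • (γ ∘ₗ LinearMap.mulRight ℝ g)) ⟨fun k hk => by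
      have := hp (k * g) (fun x => mul_nonneg (hk x) (by linarith [h1 x]))
      simp only [LinearMap.smul_apply, LinearMap.comp_apply, LinearMap.mulRight_apply, smul_eq_mul]
      positivity, by
      simp only [LinearMap.smul_apply, LinearMap.comp_apply, LinearMap.mulRight_apply,
        smul_eq_mul, one_mul]
      field_simp⟩
    (x₂ := (1 - γ g)⁻¹ • (γ ∘ₗ LinearMap.mulRight ℝ (1 - g))) ⟨fun k hk => by
      have := hp (k * (1 - g)) (fun x => mul_nonneg (hk x) (by
        simp only [ContinuousMap.sub_apply, ContinuousMap.one_apply]; linarith [h2 x]))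
      simp only [LinearMap.smul_apply, LinearMap.comp_apply, LinearMap.mulRight_apply, smul_eq_mul]
      positivity, by
      simp only [LinearMap.smul_apply, LinearMap.comp_apply, LinearMap.mulRight_apply,
        smul_eq_mul, one_mul, map_sub, h11]
      field_simp⟩
    ⟨γ g, 1 - γ g, hpos, hpos', by ring, by
      ext k
      simp only [LinearMap.add_apply, LinearMap.smul_apply, LinearMap.comp_apply,
        LinearMap.mulRight_apply, smul_eq_mul, mul_sub, map_sub, mul_one]
      field_simp
      ring⟩
  have := congrArg (fun l => l f) key
  simp only [LinearMap.smul_apply, LinearMap.comp_apply, LinearMap.mulRight_apply,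
    smul_eq_mul] at this
  rw [← this]
  field_simp

theorem aux_mul'
    {X : Type*} [TopologicalSpace X] [CompactSpace X] [T2Space X]
    (γ : C(X, ℝ) →ₗ[ℝ] ℝ)
    (h : γ ∈ Set.extremePoints ℝ {γ' : C(X, ℝ) →ₗ[ℝ] ℝ |
        (∀ f : C(X, ℝ), (∀ x, 0 ≤ f x) → 0 ≤ γ' f) ∧ γ' 1 = 1})
    (f g : C(X, ℝ)) :
    γ (f * g) = γ f * γ g := by
  have h11 : γ 1 = 1 := h.1.2
  have hM : 0 < ‖g‖ + 1 := by positivity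
  have hb : ∀ x, |(4 * (‖g‖ + 1))⁻¹ * g x| ≤ 1 / 4 := fun x => by
    have := g.norm_coe_le_norm x
    rw [Real.norm_eq_abs] at this
    rw [abs_mul, abs_of_pos (by positivity), inv_mul_le_iff₀ (by positivity)]
    linarith
  have := aux_mul γ h ((1 / 2 : ℝ) • 1 + (4 * (‖g‖ + 1))⁻¹ • g)
    (fun x => by
      have := abs_le.1 (hb x)
      simp only [ContinuousMap.add_apply, ContinuousMap.smul_apply, ContinuousMap.one_apply,
        smul_eq_mul]
      linarith)
    (fun x => by
      have := abs_le.1 (hb x)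
      simp only [ContinuousMap.add_apply, ContinuousMap.smul_apply, ContinuousMap.one_apply,
        smul_eq_mul]
      linarith) f
  rw [mul_add, mul_smul_comm, mul_smul_comm, mul_one, map_add, map_add, map_smul, map_smul,
    map_smul, map_smul, h11] at this
  simp only [smul_eq_mul] at this
  field_simp at this
  linarith

/-- a state on `C(X,ℝ)` (`X` compact Hausdorff) is an extreme point of the
state space iff it is evaluation at some point `x ∈ X`. -/
theorem stmt_9
    {X : Type*} [TopologicalSpace X] [CompactSpace X] [T2Space X]
    (γ : C(X, ℝ) →ₗ[ℝ] ℝ)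
    (hγ : γ ∈ {γ' : C(X, ℝ) →ₗ[ℝ] ℝ |
      (∀ f : C(X, ℝ), (∀ x, 0 ≤ f x) → 0 ≤ γ' f) ∧ γ' 1 = 1}) :
    γ ∈ Set.extremePoints ℝ {γ' : C(X, ℝ) →ₗ[ℝ] ℝ |
        (∀ f : C(X, ℝ), (∀ x, 0 ≤ f x) → 0 ≤ γ' f) ∧ γ' 1 = 1} ↔
      ∃ x : X, ∀ f : C(X, ℝ), γ f = f x := by
  constructor
  · intro h
    obtain ⟨x, hx⟩ := (WeakDual.CharacterSpace.continuousMapEval_bijective (X := X) (𝕜 := ℝ)).2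
      (WeakDual.CharacterSpace.equivAlgHom.symm (AlgHom.ofLinearMap γ hγ.2 (aux_mul' γ h)))
    refine ⟨x, fun f => ?_⟩
    have := congrArg (fun l => l f) hx
    exact this.symm
  · rintro ⟨x, hx⟩
    refine ⟨hγ, ?_⟩
    rintro γ₁ ⟨p1, o1⟩ γ₂ ⟨p2, o2⟩ ⟨a, b, ha, hb, hab, rfl⟩
    ext f
    rw [hx f]
    have h0 := hx |f - f x • 1|
    have n1 := p1 |f - f x • 1| (fun y => by simp)
    have n2 := p2 |f - f x • 1| (fun y => by simp)
    have u1 := p1 (|f - f x • 1| - (f - f x • 1)) (fun y => by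
      have := le_abs_self (f y - f x)
      simp; linarith)
    have u2 := p1 (|f - f x • 1| + (f - f x • 1)) (fun y => by
      have := neg_abs_le (f y - f x)
      simp; linarith)
    have e : (|f - f x • 1| : C(X, ℝ)) x = 0 := by simp
    rw [e] at h0
    simp only [LinearMap.add_apply, LinearMap.smul_apply, smul_eq_mul] at h0
    have z : γ₁ |f - f x • 1| = 0 := by
      have := mul_nonneg hb.le n2
      have h3 : a * γ₁ |f - f x • 1| ≤ 0 := by linarith
      nlinarith
    rw [map_sub, z, map_sub, map_smul, o1, smul_eq_mul] at u1
    rw [map_add, z, map_sub, map_smul, o1, smul_eq_mul] at u2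
    linarith
end

section
/- Let X be a compact Hausdorff topological space. Then the following are equivalent: (a) C(X,ℝ) has the Rickart property, i.e., for every f ∈ C(X,ℝ) there exists p ∈ C(X,ℝ) with p·p = p such that for all g ∈ C(X,ℝ), f·g = 0 if and only if g = p·g; (b) X is basically disconnected, i.e., the closure of every open Fσ subset of X is open. -/
/-- for a compact Hausdorff space `X`, the ring `C(X,ℝ)` has the Rickart
property iff `X` is basically disconnected (closures of open Fσ sets are open). -/
theorem stmt_10
    {X : Type*} [TopologicalSpace X] [CompactSpace X] [T2Space X] :
    (∀ f : C(X, ℝ), ∃ p : C(X, ℝ), p * p = p ∧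
        ∀ g : C(X, ℝ), f * g = 0 ↔ g = p * g) ↔
      (∀ U : Set X, IsOpen U →
        (∃ F : ℕ → Set X, (∀ n, IsClosed (F n)) ∧ U = ⋃ n, F n) →
        IsOpen (closure U)) := by
  constructor
  · intro H U hU hF
    obtain ⟨F, hF, hUF⟩ := hF
    have hG : IsGδ Uᶜ := by
      rw [hUF, Set.compl_iUnion]
      exact IsGδ.iInter_of_isOpen fun n => (hF n).isOpen_compl
    obtain ⟨f0, hf0, -, -, -⟩ := exists_continuous_one_zero_of_isCompact_of_isGδ
      hU.isClosed_compl.isCompact hG isClosed_empty (Set.disjoint_empty _)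
    -- f vanishes exactly off U
    have hf : ∀ x, (1 - f0) x = 0 ↔ x ∉ U := by
      intro x
      have h1 : x ∉ U ↔ f0 x = 1 := by
        have : x ∈ Uᶜ ↔ x ∈ f0 ⁻¹' {1} := by rw [← hf0]
        simpa using this
      rw [h1, ContinuousMap.sub_apply, ContinuousMap.one_apply, sub_eq_zero, eq_comm]
    generalize (1 - f0) = f at hf
    obtain ⟨p, hp, hpg⟩ := H f
    have hfp : f * p = 0 := (hpg p).2 hp.symm
    have key : closure U = {x | p x ≠ 1} := by
      apply Set.Subset.antisymm
      · have : closure U ⊆ {x | p x = 0} := by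
          refine closure_minimal ?_ (isClosed_eq p.continuous continuous_const)
          intro x hx
          have h := DFunLike.congr_fun hfp x
          simp only [ContinuousMap.mul_apply, ContinuousMap.zero_apply, mul_eq_zero] at h
          exact h.resolve_left (fun h' => (hf x).1 h' hx)
        intro x hx h1
        have h0 : p x = 0 := this hx
        rw [h0] at h1
        exact zero_ne_one h1
      · intro x hx
        by_contra hxU
        obtain ⟨g, hg0, hg1, -⟩ := exists_continuous_zero_one_of_isClosed
          (isClosed_closure (s := U)) (isClosed_singleton (x := x))
          (Set.disjoint_singleton_right.2 hxU)
        have hfg : f * g = 0 := by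
          ext y
          by_cases hy : y ∈ U
          · have : g y = 0 := hg0 (subset_closure hy)
            simp [this]
          · simp [(hf y).2 hy]
        have h := DFunLike.congr_fun ((hpg g).1 hfg) x
        have hgx : g x = 1 := hg1 rfl
        simp only [ContinuousMap.mul_apply, hgx, mul_one] at h
        exact hx h.symm
    rw [key]
    exact isOpen_ne_fun p.continuous continuous_const
  · intro H f
    have hU : IsOpen {x | f x ≠ 0} := isOpen_ne_fun f.continuous continuous_const
    have ho : IsOpen (closure {x | f x ≠ 0}) := by
      refine H _ hU ⟨fun n => {x | 1 / ((n : ℝ) + 1) ≤ |f x|}, fun n => isClosed_le continuous_const f.continuous.abs, ?_⟩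
      ext x
      simp only [Set.mem_setOf_eq, Set.mem_iUnion]
      constructor
      · intro h
        obtain ⟨n, hn⟩ := exists_nat_one_div_lt (abs_pos.mpr h)
        exact ⟨n, hn.le⟩
      · rintro ⟨n, hn⟩
        exact abs_pos.mp (lt_of_lt_of_le Nat.one_div_pos_of_nat hn)
    have hc : IsClopen (closure {x | f x ≠ 0}) := ⟨isClosed_closure, ho⟩
    classical
    refine ⟨⟨(closure {x | f x ≠ 0})ᶜ.indicator (fun _ => (1:ℝ)), ?_⟩, ?_, ?_⟩
    · exact hc.compl.continuous_indicator continuous_const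
    · ext x
      by_cases h : x ∈ closure {x | f x ≠ 0} <;> simp [Set.indicator, h]
    · intro g
      constructor
      · intro h
        have h0 : ∀ x ∈ closure {x | f x ≠ 0}, g x = 0 := by
          have : closure {x | f x ≠ 0} ⊆ {x | g x = 0} := by
            refine closure_minimal ?_ (isClosed_eq g.continuous continuous_const)
            intro x hx
            have := DFunLike.congr_fun h x
            simp only [ContinuousMap.mul_apply, ContinuousMap.zero_apply, mul_eq_zero] at this
            exact this.resolve_left hx
          exact this
        ext x
        by_cases hx : x ∈ closure {x | f x ≠ 0}
        · simp [h0 x hx]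
        · simp only [ContinuousMap.mul_apply, ContinuousMap.coe_mk]
          rw [Set.indicator_of_mem (by exact hx), one_mul]
      · intro h
        ext x
        by_cases hx : f x = 0
        · simp [hx]
        · have := DFunLike.congr_fun h x
          simp only [ContinuousMap.mul_apply, ContinuousMap.coe_mk] at this
          rw [Set.indicator_of_notMem (by
            intro h; exact h (subset_closure hx)), zero_mul] at this
          simp [this]
end

section
/- Let X be a compact Hausdorff topological space. Then X is basically disconnected (the closure of every open Fσ subset of X is open) if and only if C(X,ℝ) is Dedekind σ-complete with respect to the pointwise order, i.e., every sequence (fₙ) in C(X,ℝ) that is bounded above by some element of C(X,ℝ) has a least upper bound in C(X,ℝ). -/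
/-- a compact Hausdorff space `X` is basically disconnected iff `C(X,ℝ)`
is Dedekind σ-complete for the pointwise order: every sequence bounded above has a
least upper bound. -/
theorem stmt_11
    {X : Type*} [TopologicalSpace X] [CompactSpace X] [T2Space X] :
    (∀ U : Set X, IsOpen U →
        (∃ F : ℕ → Set X, (∀ n, IsClosed (F n)) ∧ U = ⋃ n, F n) →
        IsOpen (closure U)) ↔
      (∀ f : ℕ → C(X, ℝ), (∃ g : C(X, ℝ), ∀ n, f n ≤ g) →
        ∃ h : C(X, ℝ), IsLUB (Set.range f) h) := by
  constructor
  · rintro H f ⟨g, hg⟩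
    let U : ℝ → Set X := fun r => ⋃ n, {x | r < f n x}
    have hUo : ∀ r, IsOpen (U r) := fun r =>
      isOpen_iUnion fun n => isOpen_lt continuous_const (f n).continuous
    have hC : ∀ r, IsOpen (closure (U r)) := by
      intro r
      refine H _ (hUo r) ⟨fun p => {x | r + 1 / ((Nat.unpair p).2 + 1 : ℝ) ≤ f (Nat.unpair p).1 x},
        fun p => isClosed_le continuous_const (f _).continuous, ?_⟩
      ext x
      simp only [U, Set.mem_iUnion, Set.mem_setOf_eq]
      constructor
      · rintro ⟨n, hn⟩
        obtain ⟨m, hm⟩ := exists_nat_one_div_lt (sub_pos.2 hn)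
        refine ⟨Nat.pair n m, ?_⟩
        rw [Nat.unpair_pair]
        dsimp only
        linarith
      · rintro ⟨p, hp⟩
        refine ⟨_, lt_of_lt_of_le ?_ hp⟩
        have : (0 : ℝ) < 1 / ((Nat.unpair p).2 + 1 : ℝ) := by positivity
        linarith
    have hanti : ∀ r s, r ≤ s → closure (U s) ⊆ closure (U r) := by
      intro r s hrs
      apply closure_mono
      apply Set.iUnion_mono
      intro n x hx
      exact lt_of_le_of_lt hrs hx
    have hle : ∀ k : C(X, ℝ), (∀ n, f n ≤ k) → ∀ r, ∀ x ∈ closure (U r), r ≤ k x := by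
      intro k hk r
      have : closure (U r) ⊆ {x | r ≤ k x} := by
        apply closure_minimal
        · intro x hx
          obtain ⟨n, hn⟩ := Set.mem_iUnion.1 hx
          exact (lt_of_lt_of_le hn (hk n x)).le
        · exact isClosed_le continuous_const k.continuous
      exact this
    have hmem : ∀ n x r, r < f n x → x ∈ closure (U r) := fun n x r h =>
      subset_closure (Set.mem_iUnion.2 ⟨n, h⟩)
    let S : X → Set ℝ := fun x => {r | x ∈ closure (U r)}
    have hb : ∀ x, BddAbove (S x) := fun x => ⟨g x, fun r hr => hle g hg r x hr⟩
    have hne : ∀ x, (S x).Nonempty := fun x => ⟨f 0 x - 1, hmem 0 x _ (by linarith)⟩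
    have hcont : Continuous (fun x => sSup (S x)) := by
      rw [OrderTopology.continuous_iff]
      intro a
      constructor
      · have : (fun x => sSup (S x)) ⁻¹' Set.Ioi a = ⋃ r ∈ Set.Ioi a, closure (U r) := by
          ext x
          simp only [Set.mem_preimage, Set.mem_Ioi, Set.mem_iUnion, exists_prop]
          constructor
          · intro h
            obtain ⟨r, hr, har⟩ := exists_lt_of_lt_csSup (hne x) h
            exact ⟨r, har, hr⟩
          · rintro ⟨r, har, hr⟩
            exact lt_of_lt_of_le har (le_csSup (hb x) hr)
        rw [this]
        exact isOpen_biUnion fun r _ => hC r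
      · have : (fun x => sSup (S x)) ⁻¹' Set.Iio a = ⋃ r ∈ Set.Iio a, (closure (U r))ᶜ := by
          ext x
          simp only [Set.mem_preimage, Set.mem_Iio, Set.mem_iUnion, exists_prop,
            Set.mem_compl_iff]
          constructor
          · intro h
            obtain ⟨r, hr, har⟩ := exists_between h
            exact ⟨r, har, fun hx => absurd (le_csSup (hb x) hx) (not_le.2 hr)⟩
          · rintro ⟨r, har, hr⟩
            refine lt_of_le_of_lt (csSup_le (hne x) fun s hs => ?_) har
            by_contra hlt
            exact hr (hanti r s (not_le.1 hlt).le hs)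
        rw [this]
        exact isOpen_biUnion fun r _ => isClosed_closure.isOpen_compl
    refine ⟨⟨_, hcont⟩, ?_, ?_⟩
    · rintro _ ⟨n, rfl⟩ x
      exact le_of_forall_lt_imp_le_of_dense fun r hr => le_csSup (hb x) (hmem n x r hr)
    · intro k hk x
      exact csSup_le (hne x) fun r hr => hle k (fun n => hk ⟨n, rfl⟩) r x hr
  · rintro H U hU ⟨F, hF, hUF⟩
    have hex : ∀ n, ∃ k : C(X, ℝ), Set.EqOn k 0 Uᶜ ∧ Set.EqOn k 1 (F n) ∧
        ∀ x, k x ∈ Set.Icc (0 : ℝ) 1 := fun n =>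
      exists_continuous_zero_one_of_isClosed hU.isClosed_compl (hF n)
        (Set.disjoint_compl_left_iff_subset.2 (hUF ▸ Set.subset_iUnion F n))
    choose k hk0 hk1 hk using hex
    obtain ⟨h, hub, hlub⟩ := H k ⟨1, fun n x => (hk n x).2⟩
    have h1 : ∀ x ∈ closure U, 1 ≤ h x := by
      have : closure U ⊆ {x | 1 ≤ h x} := by
        apply closure_minimal
        · intro x hx
          rw [hUF] at hx
          obtain ⟨n, hn⟩ := Set.mem_iUnion.1 hx
          have h2 : k n x ≤ h x := hub ⟨n, rfl⟩ x
          rw [hk1 n hn] at h2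
          exact h2
        · exact isClosed_le continuous_const h.continuous
      exact this
    have h0 : ∀ x, x ∉ closure U → h x ≤ 0 := by
      intro x hx
      obtain ⟨q, hq0, hq1, hq⟩ := exists_continuous_zero_one_of_isClosed
        (isClosed_singleton (x := x)) (isClosed_closure (s := U))
        (Set.disjoint_singleton_left.2 hx)
      have : h ≤ q := by
        apply hlub
        rintro _ ⟨n, rfl⟩ y
        change k n y ≤ q y
        by_cases hy : y ∈ U
        · rw [hq1 (subset_closure hy)]
          exact (hk n y).2
        · rw [hk0 n hy]
          exact (hq y).1
      have h3 : h x ≤ q x := this x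
      rw [hq0 rfl] at h3
      exact h3
    have : closure U = {x | 0 < h x} := by
      ext x
      constructor
      · intro hx
        exact lt_of_lt_of_le one_pos (h1 x hx)
      · intro hx
        by_contra hn
        exact absurd (h0 x hn) (not_le.2 hx)
    rw [this]
    exact isOpen_lt continuous_const h.continuous
end

section
/- Let X be a compact Hausdorff topological space. Then X is basically disconnected (the closure of every open Fσ subset of X is open) if and only if C(X,ℝ) is monotone σ-complete with respect to the pointwise order, i.e., for every sequence f₁ ≤ f₂ ≤ f₃ ≤ ⋯ in C(X,ℝ) that is bounded above by some element of C(X,ℝ), there exists f ∈ C(X,ℝ) that is the least upper bound of the sequence. -/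
theorem aux_open_to_complete
    {X : Type*} [TopologicalSpace X]
    (H : ∀ U : Set X, IsOpen U →
        (∃ F : ℕ → Set X, (∀ n, IsClosed (F n)) ∧ U = ⋃ n, F n) →
        IsOpen (closure U))
    (f : ℕ → C(X, ℝ)) (g : C(X, ℝ)) (hg : ∀ n, f n ≤ g) :
    ∃ h : C(X, ℝ), IsLUB (Set.range f) h := by
  let U : ℝ → Set X := fun t => {x | ∃ n, t < f n x}
  have hU : ∀ t, IsOpen (U t) := by
    intro t
    have : U t = ⋃ n, {x | t < f n x} := by ext x; simp [U]
    rw [this]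
    exact isOpen_iUnion fun n => isOpen_lt continuous_const (f n).continuous
  have hV : ∀ t, IsOpen (closure (U t)) := by
    intro t
    refine H _ (hU t) ⟨fun k => {x | t + 1 / ((k.unpair.2 : ℝ) + 1) ≤ f k.unpair.1 x}, ?_, ?_⟩
    · intro k
      exact isClosed_le continuous_const (f _).continuous
    · ext x
      simp only [U, Set.mem_ofPred_eq, Set.mem_iUnion]
      constructor
      · rintro ⟨n, hn⟩
        obtain ⟨m, hm⟩ := exists_nat_one_div_lt (sub_pos.2 hn)
        refine ⟨Nat.pair n m, ?_⟩
        simp only [Nat.unpair_pair]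
        linarith
      · rintro ⟨k, hk⟩
        refine ⟨_, lt_of_lt_of_le ?_ hk⟩
        have : (0 : ℝ) < 1 / ((k.unpair.2 : ℝ) + 1) := by positivity
        linarith
  have hanti : ∀ s t, s ≤ t → closure (U t) ⊆ closure (U s) := by
    intro s t hst
    apply closure_mono
    rintro x ⟨n, hn⟩
    exact ⟨n, hst.trans_lt hn⟩
  have hle : ∀ k : C(X, ℝ), (∀ n, f n ≤ k) → ∀ t, ∀ x ∈ closure (U t), t ≤ k x := by
    intro k hk t x hx
    have hc : IsClosed {x | t ≤ k x} := isClosed_le continuous_const k.continuous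
    refine closure_minimal ?_ hc hx
    rintro y ⟨n, hn⟩
    exact hn.le.trans (hk n y)
  let S : X → Set ℝ := fun x => {t | x ∈ closure (U t)}
  have hbdd : ∀ x, BddAbove (S x) := fun x => ⟨g x, fun t ht => hle g hg t x ht⟩
  have hmem : ∀ x n t, t < f n x → t ∈ S x := fun x n t ht => subset_closure ⟨n, ht⟩
  have hne : ∀ x, (S x).Nonempty := fun x => ⟨f 0 x - 1, hmem x 0 _ (by linarith)⟩
  have hcont : Continuous (fun x => sSup (S x)) := by
    rw [continuous_iff_continuousAt]
    intro x
    refine tendsto_order.2 ⟨fun a ha => ?_, fun a ha => ?_⟩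
    · obtain ⟨b, hab, hb⟩ := exists_between ha
      obtain ⟨t, ht, hbt⟩ := exists_lt_of_lt_csSup (hne x) hb
      filter_upwards [(hV t).mem_nhds ht] with y hy
      exact (hab.trans hbt).trans_le (le_csSup (hbdd y) hy)
    · obtain ⟨b, hb, hba⟩ := exists_between ha
      have hx : x ∉ closure (U b) := fun h => absurd (le_csSup (hbdd x) h) (not_le.2 hb)
      filter_upwards [isClosed_closure.isOpen_compl.mem_nhds hx] with y hy
      refine lt_of_le_of_lt (csSup_le (hne y) fun t ht => ?_) hba
      by_contra! hlt
      exact hy (hanti b t hlt.le ht)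
  refine ⟨⟨fun x => sSup (S x), hcont⟩, ?_, ?_⟩
  · rintro _ ⟨n, rfl⟩ x
    exact le_of_forall_lt fun t ht => by
      obtain ⟨b, htb, hb⟩ := exists_between ht
      exact htb.trans_le (le_csSup (hbdd x) (hmem x n b hb))
  · intro k hk x
    exact csSup_le (hne x) fun t ht => hle k (fun n => hk ⟨n, rfl⟩) t x ht

theorem aux_complete_to_open
    {X : Type*} [TopologicalSpace X] [CompactSpace X] [T2Space X]
    (H : ∀ f : ℕ → C(X, ℝ), Monotone f → (∃ g : C(X, ℝ), ∀ n, f n ≤ g) →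
        ∃ h : C(X, ℝ), IsLUB (Set.range f) h)
    (U : Set X) (hU : IsOpen U) (F : ℕ → Set X) (hF : ∀ n, IsClosed (F n))
    (hUF : U = ⋃ n, F n) : IsOpen (closure U) := by
  have hd : ∀ n, Disjoint Uᶜ (F n) := by
    intro n
    rw [Set.disjoint_left]
    intro x hx hxF
    exact hx (hUF ▸ Set.mem_iUnion.2 ⟨n, hxF⟩)
  choose g hg0 hg1 hg using fun n =>
    exists_continuous_zero_one_of_isClosed hU.isClosed_compl (hF n) (hd n)
  have hub : ∀ k : C(X, ℝ), (∀ n, g n ≤ k) → ∀ n, partialSups g n ≤ k :=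
    fun k hk n => partialSups_le g n k fun i _ => hk i
  obtain ⟨h, h1, h2⟩ := H (partialSups g) (partialSups g).monotone
    ⟨1, hub 1 fun n x => (hg n x).2⟩
  have hc1 : ∀ x ∈ closure U, 1 ≤ h x := by
    intro x hx
    have hc : IsClosed {x | 1 ≤ h x} := isClosed_le continuous_const h.continuous
    refine closure_minimal ?_ hc hx
    intro y hy
    rw [hUF] at hy
    obtain ⟨n, hn⟩ := Set.mem_iUnion.1 hy
    have e : g n y = 1 := hg1 n hn
    have h3 : g n ≤ h := (le_partialSups g n).trans (h1 ⟨n, rfl⟩)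
    have h4 : g n y ≤ h y := h3 y
    show 1 ≤ h y
    linarith
  have hc0 : ∀ x, x ∉ closure U → h x ≤ 0 := by
    intro x hx
    obtain ⟨k, hk0, hk1, hk⟩ := exists_continuous_zero_one_of_isClosed
      (isClosed_singleton (x := x)) (isClosed_closure (s := U)) (by simpa using hx)
    have h3 : h ≤ k := by
      apply h2
      rintro _ ⟨n, rfl⟩
      refine hub k (fun n y => ?_) n
      show g n y ≤ k y
      by_cases hy : y ∈ U
      · have e : k y = 1 := hk1 (subset_closure hy)
        rw [e]
        exact (hg n y).2
      · have e : g n y = 0 := hg0 n hy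
        rw [e]
        exact (hk y).1
    have e : k x = 0 := hk0 rfl
    have h4 : h x ≤ k x := h3 x
    linarith
  have : closure U = {x | 0 < h x} := by
    ext x
    constructor
    · intro hx
      exact zero_lt_one.trans_le (hc1 x hx)
    · intro hx
      by_contra hn
      exact absurd (hc0 x hn) (not_le.2 hx)
  rw [this]
  exact isOpen_lt continuous_const h.continuous

/-- a compact Hausdorff space `X` is basically disconnected iff `C(X,ℝ)`
is monotone σ-complete for the pointwise order: every ascending sequence bounded above
has a least upper bound. -/
theorem stmt_12
    {X : Type*} [TopologicalSpace X] [CompactSpace X] [T2Space X] :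
    (∀ U : Set X, IsOpen U →
        (∃ F : ℕ → Set X, (∀ n, IsClosed (F n)) ∧ U = ⋃ n, F n) →
        IsOpen (closure U)) ↔
      (∀ f : ℕ → C(X, ℝ), Monotone f → (∃ g : C(X, ℝ), ∀ n, f n ≤ g) →
        ∃ h : C(X, ℝ), IsLUB (Set.range f) h) := by
  constructor
  · rintro H f _ ⟨g, hg⟩
    exact aux_open_to_complete H f g hg
  · rintro H U hU ⟨F, hF, hUF⟩
    exact aux_complete_to_open H U hU F hF hUF
end

section
/- Let X be a Stone space, i.e., a compact Hausdorff space in which the clopen subsets form a basis for the topology. Then X is basically disconnected (the closure of every open Fσ subset of X is open) if and only if the Boolean algebra of clopen subsets of X is σ-complete, i.e., every countable family of clopen subsets of X has a least upper bound in the lattice of clopen subsets of X. -/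
/-- a Stone space (compact Hausdorff with a basis of clopen sets) is
basically disconnected iff its Boolean algebra of clopen sets is σ-complete, i.e. every
countable family of clopen sets has a least upper bound among the clopen sets. -/
theorem stmt_13
    {X : Type*} [TopologicalSpace X] [CompactSpace X] [T2Space X]
    (hbasis : ∀ (x : X) (U : Set X), IsOpen U → x ∈ U →
      ∃ K : Set X, IsClopen K ∧ x ∈ K ∧ K ⊆ U) :
    (∀ U : Set X, IsOpen U →
        (∃ F : ℕ → Set X, (∀ n, IsClosed (F n)) ∧ U = ⋃ n, F n) →
        IsOpen (closure U)) ↔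
      (∀ K : ℕ → Set X, (∀ n, IsClopen (K n)) →
        ∃ L : Set X, IsClopen L ∧ (∀ n, K n ⊆ L) ∧
          ∀ M : Set X, IsClopen M → (∀ n, K n ⊆ M) → L ⊆ M) := by
  constructor
  · intro h K hK
    have hU : IsOpen (⋃ n, K n) := isOpen_iUnion fun n => (hK n).isOpen
    refine ⟨closure (⋃ n, K n),
      ⟨isClosed_closure, h _ hU ⟨K, fun n => (hK n).isClosed, rfl⟩⟩, ?_, ?_⟩
    · intro n
      exact (Set.subset_iUnion K n).trans subset_closure
    · intro M hM hKM
      exact closure_minimal (Set.iUnion_subset hKM) hM.isClosed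
  · rintro h U hU ⟨F, hF, hUF⟩
    have key : ∀ n, ∃ K : Set X, IsClopen K ∧ F n ⊆ K ∧ K ⊆ U := by
      intro n
      refine (hF n).isCompact.induction_on
        (p := fun s => ∃ K : Set X, IsClopen K ∧ s ⊆ K ∧ K ⊆ U) ?_ ?_ ?_ ?_
      · exact ⟨∅, isClopen_empty, subset_rfl, Set.empty_subset _⟩
      · rintro s t hst ⟨K, h1, h2, h3⟩
        exact ⟨K, h1, hst.trans h2, h3⟩
      · rintro s t ⟨K, h1, h2, h3⟩ ⟨K', h1', h2', h3'⟩
        exact ⟨K ∪ K', h1.union h1', Set.union_subset_union h2 h2', Set.union_subset h3 h3'⟩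
      · intro x hx
        have hxU : x ∈ U := by
          rw [hUF]
          exact Set.mem_iUnion_of_mem n hx
        obtain ⟨K, h1, h2, h3⟩ := hbasis x U hU hxU
        exact ⟨K, mem_nhdsWithin_of_mem_nhds (h1.isOpen.mem_nhds h2), K, h1, subset_rfl, h3⟩
    choose K hK hFK hKU using key
    obtain ⟨L, hL, hKL, hmin⟩ := h K hK
    have hUL : closure U ⊆ L := by
      refine closure_minimal ?_ hL.isClosed
      rw [hUF]
      exact Set.iUnion_subset fun n => (hFK n).trans (hKL n)
    have hLU : L ⊆ closure U := by
      intro x hx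
      by_contra hxU
      obtain ⟨V, hV, hxV, hVU⟩ := hbasis x (closure U)ᶜ isClosed_closure.isOpen_compl hxU
      have := hmin (L \ V) (hL.diff hV) (fun n y hy =>
        ⟨hKL n hy, fun hyV => hVU hyV (subset_closure (hKU n hy))⟩) hx
      exact this.2 hxV
    rw [hUL.antisymm hLU]
    exact hL.isOpen
end

section
/- Let V be an Archimedean lattice-ordered real vector space (Riesz space) with order unit v, and let ρ be a state on (V,v). Then the following are mutually equivalent: (i) ρ is an extreme point of the convex set of all states on (V,v); (ii) ρ is a lattice homomorphism, i.e., ρ(a ⊔ b) = max(ρ(a), ρ(b)) and ρ(a ⊓ b) = min(ρ(a), ρ(b)) for all a, b ∈ V; (iii) ρ(a ⊓ b) = min(ρ(a), ρ(b)) for all a, b ∈ V with 0 ≤ a and 0 ≤ b. -/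
theorem aux_zero {V : Type*} [AddCommGroup V] [Lattice V] [Module ℝ V] (v : V)
    (hunit : ∀ a : V, ∃ n : ℕ, a ≤ n • v)
    (hsub : ∀ a b : V, a ≤ b → 0 ≤ b - a)
    (σ : V →ₗ[ℝ] ℝ) (hσ : ∀ a, 0 ≤ a → 0 ≤ σ a) (h0 : σ v = 0) (x : V) : σ x = 0 := by
  have key : ∀ y, σ y ≤ 0 := by
    intro y
    obtain ⟨n, hn⟩ := hunit y
    have := hσ _ (hsub _ _ hn)
    rw [map_sub, map_nsmul, h0] at this
    simp at this
    exact this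
  have h1 := key x
  have h2 := key (-x)
  rw [map_neg] at h2
  linarith

/-- A positive functional below an extreme state is a multiple of it. -/
theorem aux_mult {V : Type*} [AddCommGroup V] [Lattice V] [Module ℝ V] (v : V) (hv : 0 ≤ v)
    (hunit : ∀ a : V, ∃ n : ℕ, a ≤ n • v)
    (hsub : ∀ a b : V, a ≤ b → 0 ≤ b - a)
    (ρ : V →ₗ[ℝ] ℝ) (h : ρ ∈ Set.extremePoints ℝ
        {ρ' : V →ₗ[ℝ] ℝ | (∀ a : V, 0 ≤ a → 0 ≤ ρ' a) ∧ ρ' v = 1})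
    (σ : V →ₗ[ℝ] ℝ) (hσ : ∀ a, 0 ≤ a → 0 ≤ σ a) (hσρ : ∀ a, 0 ≤ a → σ a ≤ ρ a) :
    ∃ t : ℝ, 0 ≤ t ∧ t ≤ 1 ∧ ∀ x, σ x = t * ρ x := by
  obtain ⟨⟨hp, h1⟩, hext⟩ := h
  have ht0 := hσ v hv
  have ht1 := hσρ v hv
  rw [h1] at ht1
  refine ⟨σ v, ht0, ht1, fun x => ?_⟩
  rcases ht0.eq_or_lt with h0 | h0
  · rw [← h0, aux_zero v hunit hsub σ hσ h0.symm]; simp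
  rcases ht1.eq_or_lt with h2 | h2
  · have := aux_zero v hunit hsub (ρ - σ) (fun a ha => by simpa using hσρ a ha)
      (by simp [h1, h2]) x
    simp at this
    rw [h2]; linarith
  have h3 : 0 < 1 - σ v := by linarith
  have := @hext ((σ v)⁻¹ • σ)
    ⟨fun a ha => by
      have := hσ a ha
      simp only [LinearMap.smul_apply, smul_eq_mul]; positivity,
     by simp [h0.ne']⟩
    ((1 - σ v)⁻¹ • (ρ - σ))
    ⟨fun a ha => by
      have : 0 ≤ ρ a - σ a := sub_nonneg.2 (hσρ a ha)
      simp only [LinearMap.smul_apply, smul_eq_mul, LinearMap.sub_apply]; positivity,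
     by simp [h1, h3.ne']⟩
    ⟨σ v, 1 - σ v, h0, h3, by ring, by
      rw [smul_smul, smul_smul, mul_inv_cancel₀ h0.ne', mul_inv_cancel₀ h3.ne']; simp⟩
  have h4 := congrArg (fun f : V →ₗ[ℝ] ℝ => f x) this
  simp only [LinearMap.smul_apply, smul_eq_mul] at h4
  rw [← h4]; field_simp

/-- for a state `ρ` on an Archimedean lattice-ordered real vector space
with order unit `v`, the following are equivalent: (i) `ρ` is an extreme point of the
state space; (ii) `ρ` is a lattice homomorphism; (iii) `ρ (a ⊓ b) = min (ρ a) (ρ b)`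
for all `0 ≤ a, b`. -/
theorem stmt_15
    {V : Type*} [AddCommGroup V] [Lattice V] [Module ℝ V]
    (hadd : ∀ a b c : V, a ≤ b → a + c ≤ b + c)
    (hsmul : ∀ (α : ℝ) (a : V), 0 ≤ α → 0 ≤ a → 0 ≤ α • a)
    (v : V) (hv : 0 ≤ v)
    (hunit : ∀ a : V, ∃ n : ℕ, a ≤ n • v)
    (harch : ∀ a : V, (∃ b : V, ∀ n : ℕ, n • a ≤ b) → a ≤ 0)
    (ρ : V →ₗ[ℝ] ℝ)
    (hρ : (∀ a : V, 0 ≤ a → 0 ≤ ρ a) ∧ ρ v = 1) :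
    (ρ ∈ Set.extremePoints ℝ
        {ρ' : V →ₗ[ℝ] ℝ | (∀ a : V, 0 ≤ a → 0 ≤ ρ' a) ∧ ρ' v = 1} ↔
      ∀ a b : V, ρ (a ⊔ b) = max (ρ a) (ρ b) ∧ ρ (a ⊓ b) = min (ρ a) (ρ b)) ∧
    (ρ ∈ Set.extremePoints ℝ
        {ρ' : V →ₗ[ℝ] ℝ | (∀ a : V, 0 ≤ a → 0 ≤ ρ' a) ∧ ρ' v = 1} ↔
      ∀ a b : V, 0 ≤ a → 0 ≤ b → ρ (a ⊓ b) = min (ρ a) (ρ b)) := by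
  haveI : IsOrderedAddMonoid V :=
    { add_le_add_left := fun a b h c => hadd a b c h }
  have hsub : ∀ a b : V, a ≤ b → 0 ≤ b - a := fun a b h => sub_nonneg.2 h
  have hsm : ∀ (c : ℝ) (x y : V), 0 ≤ c → x ≤ y → c • x ≤ c • y := fun c x y hc h => by
    have := hsmul c _ hc (hsub _ _ h)
    rw [smul_sub] at this
    exact sub_nonneg.1 this
  obtain ⟨hpos, hρv⟩ := hρ
  have hmono : ∀ x y : V, x ≤ y → ρ x ≤ ρ y := fun x y h => by
    have := hpos _ (hsub _ _ h)
    rw [map_sub] at this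
    linarith
  have h32 : (∀ a b : V, 0 ≤ a → 0 ≤ b → ρ (a ⊓ b) = min (ρ a) (ρ b)) →
      ∀ a b : V, ρ (a ⊔ b) = max (ρ a) (ρ b) ∧ ρ (a ⊓ b) = min (ρ a) (ρ b) := by
    intro h a b
    have hinf : ρ (a ⊓ b) = min (ρ a) (ρ b) := by
      have h1 := h (a - a ⊓ b) (b - a ⊓ b) (hsub _ _ inf_le_left) (hsub _ _ inf_le_right)
      rw [← inf_sub, sub_self, map_zero, map_sub, map_sub, min_sub_sub_right] at h1
      linarith
    refine ⟨?_, hinf⟩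
    have h1 : ρ (a ⊓ b) + ρ (a ⊔ b) = ρ a + ρ b := by
      rw [← map_add, inf_add_sup, map_add]
    have h2 := min_add_max (ρ a) (ρ b)
    linarith
  have h21 : (∀ a b : V, ρ (a ⊔ b) = max (ρ a) (ρ b) ∧ ρ (a ⊓ b) = min (ρ a) (ρ b)) →
      ρ ∈ Set.extremePoints ℝ
        {ρ' : V →ₗ[ℝ] ℝ | (∀ a : V, 0 ≤ a → 0 ≤ ρ' a) ∧ ρ' v = 1} := by
    intro h
    refine ⟨⟨hpos, hρv⟩, ?_⟩
    rintro σ ⟨hσ, hσv⟩ τ ⟨hτ, hτv⟩ ⟨s, t, hs, ht, hst, hc⟩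
    have hker : ∀ x, ρ x = 0 → σ x ≤ 0 := by
      intro x hx
      have h1 : ρ (x ⊔ 0) = 0 := by rw [(h x 0).1, hx]; simp
      have h2 := hσ (x ⊔ 0) le_sup_right
      have h3 := hτ (x ⊔ 0) le_sup_right
      have h4 := hσ _ (hsub _ _ (le_sup_left : x ≤ x ⊔ 0))
      rw [map_sub] at h4
      rw [← hc] at h1
      simp only [LinearMap.add_apply, LinearMap.smul_apply, smul_eq_mul] at h1
      have h5 : 0 ≤ t * τ (x ⊔ 0) := by positivity
      have h6 : σ (x ⊔ 0) ≤ 0 := by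
        by_contra hh
        have : 0 < s * σ (x ⊔ 0) := mul_pos hs (not_le.1 hh)
        linarith
      linarith
    ext x
    have h1 := hker (x - ρ x • v) (by simp [hρv])
    have h2 := hker (-(x - ρ x • v)) (by simp [hρv])
    simp only [map_neg, map_sub, map_smul, hσv, smul_eq_mul] at h1 h2
    linarith
  have h13 : ρ ∈ Set.extremePoints ℝ
        {ρ' : V →ₗ[ℝ] ℝ | (∀ a : V, 0 ≤ a → 0 ≤ ρ' a) ∧ ρ' v = 1} →
      ∀ a b : V, 0 ≤ a → 0 ≤ b → ρ (a ⊓ b) = min (ρ a) (ρ b) := by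
    intro h
    have hplus : ∀ a : V, ρ (a ⊔ 0) = max (ρ a) 0 := by
      intro a
      by_cases ha : a = 0
      · simp [ha]
      have hle : ∀ c : ℝ, 0 < c → ∀ x : V, (c • x) ⊔ 0 ≤ c • (x ⊔ 0) := fun c hc x =>
        sup_le (hsm c _ _ hc.le le_sup_left) (hsmul c _ hc.le le_sup_right)
      have hhom : ∀ c : ℝ, 0 < c → ∀ x : V, ρ ((c • x) ⊔ 0) = c * ρ (x ⊔ 0) := by
        intro c hc x
        have h1 := hmono _ _ (hle c hc x)
        have h2 := hmono _ _ (hsm c _ _ hc.le (hle c⁻¹ (inv_pos.2 hc) (c • x)))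
        rw [smul_smul, smul_smul, inv_mul_cancel₀ hc.ne', mul_inv_cancel₀ hc.ne', one_smul,
          one_smul, map_smul, smul_eq_mul] at h2
        rw [map_smul, smul_eq_mul] at h1
        exact le_antisymm h1 h2
      obtain ⟨σ, hσ1, hσ2⟩ := exists_extension_of_le_sublinear
        (LinearPMap.mkSpanSingleton a (ρ (a ⊔ 0)) ha) (fun x => ρ (x ⊔ 0)) hhom
        (fun x y => by
          rw [← map_add]
          exact hmono _ _ (sup_le (add_le_add le_sup_left le_sup_left)
            (add_nonneg le_sup_right le_sup_right)))
        (by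
          rintro ⟨x, hx⟩
          obtain ⟨c, rfl⟩ := Submodule.mem_span_singleton.1 hx
          have e : (LinearPMap.mkSpanSingleton (K := ℝ) a (ρ (a ⊔ 0)) ha) ⟨c • a, hx⟩
            = c • ρ (a ⊔ 0) := LinearPMap.mkSpanSingleton'_apply _ _ _ _ _
          rw [e, smul_eq_mul]
          have hp := hpos (a ⊔ 0) le_sup_right
          rcases le_or_gt c 0 with hc | hc
          · exact (mul_nonpos_of_nonpos_of_nonneg hc hp).trans (hpos _ le_sup_right)
          · exact (hhom c hc a).ge)
      have hσa : σ a = ρ (a ⊔ 0) := by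
        have := hσ1 ⟨a, Submodule.mem_span_singleton_self a⟩
        rw [LinearPMap.mkSpanSingleton_apply] at this
        exact this
      obtain ⟨t, ht0, ht1, ht⟩ := aux_mult v hv hunit hsub ρ h σ
        (fun x hx => by
          have := hσ2 (-x)
          simp only [sup_eq_right.2 (neg_nonpos.2 hx), map_neg, map_zero] at this
          linarith)
        (fun x hx => by
          have := hσ2 x
          simpa only [sup_eq_left.2 hx] using this)
      have e := ht a
      rw [hσa] at e
      have h1 := hmono _ _ (le_sup_left : a ≤ a ⊔ 0)
      have h2 := hpos (a ⊔ 0) le_sup_right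
      apply le_antisymm _ (max_le h1 h2)
      rcases le_total (ρ a) 0 with h3 | h3
      · exact le_max_of_le_right (by nlinarith)
      · exact le_max_of_le_left (by nlinarith)
    intro a b _ _
    have h1 := hplus (a - b)
    have h2 : (a - b) ⊔ 0 = a ⊔ b - b := by rw [sup_sub, sub_self]
    have h3 : ρ (a ⊓ b) + ρ (a ⊔ b) = ρ a + ρ b := by
      rw [← map_add, inf_add_sup, map_add]
    rw [h2, map_sub, map_sub] at h1
    have h4 := min_add_max (ρ a) (ρ b)
    have h5 : max (ρ a - ρ b) 0 = max (ρ a) (ρ b) - ρ b := by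
      rw [← max_sub_sub_right, sub_self]
    linarith
  exact ⟨⟨fun h => h32 (h13 h), h21⟩, ⟨h13, fun h => h21 (h32 h)⟩⟩
end

section
/- Let X be a compact Hausdorff basically disconnected topological space (the closure of every open Fσ subset of X is open), and let γ be a state on C(X,ℝ). Then γ is an extreme point of the convex set of all states on C(X,ℝ) if and only if γ is multiplicative, i.e., γ(f·g) = γ(f)·γ(g) for all f, g ∈ C(X,ℝ). -/
/-- on a compact Hausdorff basically disconnected space `X`, a state on
`C(X,ℝ)` is an extreme point of the state space iff it is multiplicative. -/
theorem stmt_16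
    {X : Type*} [TopologicalSpace X] [CompactSpace X] [T2Space X]
    (hbd : ∀ U : Set X, IsOpen U →
      (∃ F : ℕ → Set X, (∀ n, IsClosed (F n)) ∧ U = ⋃ n, F n) →
      IsOpen (closure U))
    (γ : C(X, ℝ) →ₗ[ℝ] ℝ)
    (hγ : (∀ f : C(X, ℝ), (∀ x, 0 ≤ f x) → 0 ≤ γ f) ∧ γ 1 = 1) :
    γ ∈ Set.extremePoints ℝ {γ' : C(X, ℝ) →ₗ[ℝ] ℝ |
        (∀ f : C(X, ℝ), (∀ x, 0 ≤ f x) → 0 ≤ γ' f) ∧ γ' 1 = 1} ↔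
      ∀ f g : C(X, ℝ), γ (f * g) = γ f * γ g := by
  classical
  rw [mem_extremePoints_iff_left]
  obtain ⟨hpos, hone⟩ := hγ
  constructor
  · rintro ⟨-, hext⟩ f g
    -- the identity for functions with values in `[1/4, 3/4]`
    have key : ∀ k : C(X, ℝ), (∀ x, 1/4 ≤ k x) → (∀ x, k x ≤ 3/4) →
        γ (f * k) = γ f * γ k := by
      intro k hk1 hk2
      have h1 : 0 ≤ γ (k - (1/4 : ℝ) • 1) := hpos _ fun x => by
        have := hk1 x
        simp; linarith
      have h2 : 0 ≤ γ ((3/4 : ℝ) • 1 - k) := hpos _ fun x => by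
        have := hk2 x
        simp; linarith
      rw [map_sub, map_smul, hone, smul_eq_mul] at h1 h2
      have ht0 : 0 < γ k := by linarith
      have ht1 : 0 < 1 - γ k := by linarith
      let γ₁ : C(X, ℝ) →ₗ[ℝ] ℝ := (γ k)⁻¹ • (γ ∘ₗ LinearMap.mulLeft ℝ k)
      let γ₂ : C(X, ℝ) →ₗ[ℝ] ℝ := (1 - γ k)⁻¹ • (γ ∘ₗ LinearMap.mulLeft ℝ (1 - k))
      have e1 : ∀ u, γ₁ u = (γ k)⁻¹ * γ (k * u) := fun u => rfl
      have e2 : ∀ u, γ₂ u = (1 - γ k)⁻¹ * γ ((1 - k) * u) := fun u => rfl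
      have hs1 := hext γ₁ ⟨?_, ?_⟩ γ₂ ⟨?_, ?_⟩ ⟨γ k, 1 - γ k, ht0, ht1, by ring, ?_⟩
      · have := congrArg (fun l : C(X, ℝ) →ₗ[ℝ] ℝ => l f) hs1
        simp only [e1] at this
        rw [mul_comm f k, ← this]
        field_simp
      · intro u hu
        rw [e1]
        refine mul_nonneg (inv_nonneg.2 ht0.le) (hpos _ fun x => ?_)
        exact mul_nonneg (by linarith [hk1 x]) (hu x)
      · rw [e1, mul_one, inv_mul_cancel₀ ht0.ne']
      · intro u hu
        rw [e2]
        refine mul_nonneg (inv_nonneg.2 ht1.le) (hpos _ fun x => ?_)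
        refine mul_nonneg ?_ (hu x)
        have := hk2 x
        simp; linarith
      · rw [e2, mul_one, map_sub, hone, inv_mul_cancel₀ ht1.ne']
      · refine LinearMap.ext fun u => ?_
        change γ k * γ₁ u + (1 - γ k) * γ₂ u = γ u
        rw [e1, e2, mul_inv_cancel_left₀ ht0.ne', mul_inv_cancel_left₀ ht1.ne',
          ← map_add]
        congr 1
        ring
    have hn : 0 ≤ ‖g‖ := norm_nonneg g
    set c : ℝ := 1 / (4 * (‖g‖ + 1)) with hc
    have hc0 : 0 < c := by positivity
    have hcb : c * ‖g‖ ≤ 1/4 := by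
      rw [hc, div_mul_eq_mul_div, div_le_iff₀ (by positivity)]
      linarith
    have hb : ∀ x, |c * g x| ≤ 1/4 := fun x => by
      rw [abs_mul, abs_of_pos hc0]
      exact (mul_le_mul_of_nonneg_left (g.norm_coe_le_norm x) hc0.le).trans hcb
    have := key ((1/2 : ℝ) • 1 + c • g)
      (fun x => by
        have := abs_le.1 (hb x)
        simp; linarith)
      (fun x => by
        have := abs_le.1 (hb x)
        simp; linarith)
    rw [mul_add, mul_smul_comm, mul_smul_comm, mul_one, map_add, map_add, map_smul, map_smul,
      map_smul, map_smul, hone] at this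
    simp only [smul_eq_mul] at this
    have h3 : c * γ (f * g) = c * (γ f * γ g) := by linarith
    exact mul_left_cancel₀ hc0.ne' h3
  · intro hmul
    refine ⟨⟨hpos, hone⟩, ?_⟩
    rintro γ₁ ⟨p1, o1⟩ γ₂ ⟨p2, o2⟩ ⟨a, b, ha, hb, hab, rfl⟩
    refine LinearMap.ext fun f => ?_
    set γ := a • γ₁ + b • γ₂ with hγ
    have expand : ∀ (l : C(X, ℝ) →ₗ[ℝ] ℝ) (s : ℝ), l 1 = 1 →
        l ((f - s • 1) * (f - s • 1)) = l (f * f) - 2 * s * l f + s ^ 2 := by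
      intro l s hl
      have : (f - s • 1) * (f - s • 1) = f * f - (2 * s) • f + (s ^ 2) • (1 : C(X, ℝ)) := by
        ext x
        simp
        ring
      rw [this, map_add, map_sub, map_smul, map_smul, hl]
      simp
    have sq : ∀ (s : ℝ) (x : X), 0 ≤ ((f - s • 1) * (f - s • 1)) x :=
      fun s x => mul_self_nonneg _
    have z : γ ((f - (γ f) • 1) * (f - (γ f) • 1)) = 0 := by
      rw [hmul, map_sub, map_smul, hone]
      simp
    have z' : a * γ₁ ((f - (γ f) • 1) * (f - (γ f) • 1))
        + b * γ₂ ((f - (γ f) • 1) * (f - (γ f) • 1)) = 0 := z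
    have q1 := p1 _ (sq (γ f))
    have q2 := p2 _ (sq (γ f))
    have z1 : γ₁ ((f - (γ f) • 1) * (f - (γ f) • 1)) ≤ 0 := by
      by_contra! h
      have := mul_pos ha h
      have := mul_nonneg hb.le q2
      linarith
    have q3 := p1 _ (sq (γ₁ f))
    rw [expand _ _ o1] at z1 q3
    have : (γ₁ f - γ f) ^ 2 ≤ 0 := by nlinarith
    have := pow_eq_zero_iff (two_ne_zero) |>.1 (le_antisymm this (sq_nonneg _))
    linarith
end

section
/- Let X be a basically disconnected Stone space, i.e., a compact Hausdorff space in which the clopen subsets form a basis for the topology and the closure of every open Fσ subset is open. Let γ be a state on C(X,ℝ) such that γ(p) ∈ {0,1} for every p ∈ C(X,ℝ) with p·p = p. Then there exists x ∈ X such that γ(f) = f(x) for all f ∈ C(X,ℝ). -/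
theorem exists_char_aux {X : Type*} [TopologicalSpace X] (K : Set X) (hK : IsClopen K) :
    ∃ p : C(X, ℝ), (∀ x ∈ K, p x = 1) ∧ (∀ x, x ∉ K → p x = 0) := by
  refine ⟨⟨K.indicator (fun _ => (1 : ℝ)), ?_⟩, ?_, ?_⟩
  · exact (IsLocallyConstant.const (1 : ℝ)).continuous.indicator (by simp [hK.frontier_eq])
  · intro x hx
    simp [hx]
  · intro x hx
    simp [hx]

/-- on a basically disconnected Stone space `X`, a state on `C(X,ℝ)`
taking only the values `0` and `1` on idempotents is evaluation at some point of `X`. -/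
theorem stmt_17
    {X : Type*} [TopologicalSpace X] [CompactSpace X] [T2Space X]
    (hbasis : ∀ (x : X) (U : Set X), IsOpen U → x ∈ U →
      ∃ K : Set X, IsClopen K ∧ x ∈ K ∧ K ⊆ U)
    (hbd : ∀ U : Set X, IsOpen U →
      (∃ F : ℕ → Set X, (∀ n, IsClosed (F n)) ∧ U = ⋃ n, F n) →
      IsOpen (closure U))
    (γ : C(X, ℝ) →ₗ[ℝ] ℝ)
    (hγ : (∀ f : C(X, ℝ), (∀ x, 0 ≤ f x) → 0 ≤ γ f) ∧ γ 1 = 1)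
    (h01 : ∀ p : C(X, ℝ), p * p = p → γ p = 0 ∨ γ p = 1) :
    ∃ x : X, ∀ f : C(X, ℝ), γ f = f x := by
  obtain ⟨hpos, hone⟩ := hγ
  choose χ hχ1 hχ0 using fun K : {K : Set X // IsClopen K} => exists_char_aux K.1 K.2
  have hχn : ∀ K x, 0 ≤ χ K x := by
    intro K x
    by_cases hx : x ∈ K.1
    · rw [hχ1 K x hx]; exact zero_le_one
    · rw [hχ0 K x hx]
  have hval : ∀ K, γ (χ K) = 0 ∨ γ (χ K) = 1 := by
    intro K
    apply h01
    ext x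
    by_cases hx : x ∈ K.1
    · simp [hχ1 K x hx]
    · simp [hχ0 K x hx]
  have key : ∃ x : X, ∀ K, x ∈ K.1 → γ (χ K) = 1 := by
    by_contra! hcon
    choose K hK hne using hcon
    obtain ⟨t, ht⟩ := isCompact_univ.elim_finite_subcover (fun x => (K x).1)
      (fun x => (K x).2.isOpen) (fun x _ => Set.mem_iUnion.2 ⟨x, hK x⟩)
    have h := hpos (∑ i ∈ t, χ (K i) - 1) (by
      intro x
      obtain ⟨i, hi, hx⟩ := Set.mem_iUnion₂.1 (ht (Set.mem_univ x))
      have h1 : χ (K i) x ≤ ∑ j ∈ t, χ (K j) x :=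
        Finset.single_le_sum (f := fun j => χ (K j) x) (fun j _ => hχn _ _) hi
      rw [hχ1 _ _ hx] at h1
      simpa using h1)
    rw [map_sub, map_sum, hone, Finset.sum_eq_zero
      (fun i _ => (hval (K i)).resolve_right (hne i))] at h
    linarith
  obtain ⟨x, hx⟩ := key
  have upper : ∀ f : C(X, ℝ), γ f ≤ f x := by
    intro f
    refine le_of_forall_pos_le_add fun ε hε => ?_
    obtain ⟨K, hK, hxK, hKU⟩ := hbasis x {y | f y < f x + ε}
      (isOpen_lt f.continuous continuous_const) (by simpa using hε)
    obtain ⟨M, hM⟩ := (isCompact_range f.continuous).bddAbove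
    have hM' : ∀ y, f y ≤ M := fun y => hM ⟨y, rfl⟩
    have h := hpos ((f x + ε) • (1 : C(X, ℝ)) + (M - (f x + ε)) • (1 - χ ⟨K, hK⟩) - f) (by
      intro y
      by_cases hy : y ∈ K
      · have h1 : f y < f x + ε := hKU hy
        have h2 := hχ1 ⟨K, hK⟩ y hy
        simp [h2]
        linarith
      · have h2 := hχ0 ⟨K, hK⟩ y hy
        simp [h2]
        linarith [hM' y])
    rw [map_sub, map_add, map_smul, map_smul, map_sub, hone, hx ⟨K, hK⟩ hxK] at h
    simp at h
    linarith
  refine ⟨x, fun f => le_antisymm (upper f) ?_⟩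
  have h := upper (-f)
  rw [map_neg] at h
  simpa using h
end
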